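/- For every super nebula N and every Δgalaxy G there exists ε = ε(N,G) > 0 such that every {N,G}-free tournament T contains a transitive subtournament of size at least |T|^ε (i.e., the pair {N,G} satisfies the Erdős–Hajnal Conjecture). -/

import Mathlib

open Finset

/-- A tournament on vertex set `Fin n`: `adj u v` means there is an arc from `u` to `v`. -/
structure Tournament (n : ℕ) where
  adj : Fin n → Fin n → Prop
  asymm : ∀ u v, adj u v → ¬ adj v u
  total : ∀ u v, u ≠ v → adj u v ∨ adj v u

namespace Tournament

variable {n N : ℕ}

/-- The position of vertex `v` in the ordering `θ`, where `θ k` is the `k`-th vertex. -/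
def pos (θ : Equiv.Perm (Fin n)) (v : Fin n) : Fin n := θ.symm v

/-- The arc `u → v` of `T` is a backward arc under the ordering `θ`. -/
def Backward (T : Tournament n) (θ : Equiv.Perm (Fin n)) (u v : Fin n) : Prop :=
  T.adj u v ∧ pos θ v < pos θ u

/-- `x` lies strictly between two elements of `L` under the ordering `θ`. -/
def BetweenSet (θ : Equiv.Perm (Fin n)) (L : Finset (Fin n)) (x : Fin n) : Prop :=
  ∃ u ∈ L, ∃ w ∈ L, pos θ u < pos θ x ∧ pos θ x < pos θ w

/-- The induced subtournament of `T` on `s` is transitive. -/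
def IsTransOn (T : Tournament n) (s : Finset (Fin n)) : Prop :=
  ∀ u ∈ s, ∀ v ∈ s, ∀ w ∈ s, T.adj u v → T.adj v w → T.adj u w

/-- The largest size of a transitive subtournament of `T` contained in `s`. -/
noncomputable def trSizeOn (T : Tournament n) (s : Finset (Fin n)) : ℕ :=
  sSup {k | ∃ t, t ⊆ s ∧ T.IsTransOn t ∧ t.card = k}

/-- `tr(T)`: the largest size of a transitive subtournament of `T`. -/
noncomputable def trSize (T : Tournament n) : ℕ := T.trSizeOn Finset.univ

/-- `T` contains `H`: some induced subtournament of `T` is isomorphic to `H`. -/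
def Contains (T : Tournament N) (H : Tournament n) : Prop :=
  ∃ f : Fin n ↪ Fin N, ∀ u v, H.adj u v ↔ T.adj (f u) (f v)

/-- `T` is `ε`-critical. -/
def EpsCritical (T : Tournament n) (ε : ℝ) : Prop :=
  ((T.trSize : ℝ) < (n : ℝ) ^ ε) ∧
  ∀ s : Finset (Fin n), s ≠ Finset.univ → ((s.card : ℝ) ^ ε ≤ (T.trSizeOn s : ℝ))

/-- `S` with center `c` is a right star of `T` under `θ`. -/
def IsRightStarAt (T : Tournament n) (θ : Equiv.Perm (Fin n)) (S : Finset (Fin n))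
    (c : Fin n) : Prop :=
  c ∈ S ∧ (S.erase c).Nonempty ∧
  (∀ v ∈ S.erase c, pos θ v < pos θ c ∧ T.adj c v) ∧
  (∀ u ∈ S, ∀ v ∈ S, T.Backward θ u v → u = c)

/-- `S` with center `c` is a left star of `T` under `θ`. -/
def IsLeftStarAt (T : Tournament n) (θ : Equiv.Perm (Fin n)) (S : Finset (Fin n))
    (c : Fin n) : Prop :=
  c ∈ S ∧ (S.erase c).Nonempty ∧
  (∀ v ∈ S.erase c, pos θ c < pos θ v ∧ T.adj v c) ∧
  (∀ u ∈ S, ∀ v ∈ S, T.Backward θ u v → v = c)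

/-- `S` with center `c` is a middle star of `T` under `θ`. -/
def IsMiddleStarAt (T : Tournament n) (θ : Equiv.Perm (Fin n)) (S : Finset (Fin n))
    (c : Fin n) : Prop :=
  c ∈ S ∧
  (∃ v ∈ S.erase c, pos θ v < pos θ c) ∧ (∃ v ∈ S.erase c, pos θ c < pos θ v) ∧
  (∀ v ∈ S.erase c, (pos θ v < pos θ c → T.adj c v) ∧ (pos θ c < pos θ v → T.adj v c)) ∧
  (∀ u ∈ S, ∀ v ∈ S, T.Backward θ u v → u = c ∨ v = c)

def IsFrontierStarAt (T : Tournament n) (θ : Equiv.Perm (Fin n)) (S : Finset (Fin n))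
    (c : Fin n) : Prop :=
  T.IsLeftStarAt θ S c ∨ T.IsRightStarAt θ S c

def IsStarAt (T : Tournament n) (θ : Equiv.Perm (Fin n)) (S : Finset (Fin n))
    (c : Fin n) : Prop :=
  T.IsLeftStarAt θ S c ∨ T.IsRightStarAt θ S c ∨ T.IsMiddleStarAt θ S c

/-- A middle star with exactly one leaf after the center (center is `u_{p-1}`). -/
def IsOneRightMiddleStarAt (T : Tournament n) (θ : Equiv.Perm (Fin n)) (S : Finset (Fin n))
    (c : Fin n) : Prop :=
  T.IsMiddleStarAt θ S c ∧ ((S.erase c).filter (fun v => pos θ c < pos θ v)).card = 1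

/-- A middle star with exactly one leaf before the center (center is `u_2`). -/
def IsOneLeftMiddleStarAt (T : Tournament n) (θ : Equiv.Perm (Fin n)) (S : Finset (Fin n))
    (c : Fin n) : Prop :=
  T.IsMiddleStarAt θ S c ∧ ((S.erase c).filter (fun v => pos θ v < pos θ c)).card = 1

/-- Kinds of super 2-nebulas. -/
inductive NebKind
  | left
  | middle
  | right

/-- Common requirements on the data of a super 2-nebula: vertex set `S`, centers `c₁, c₂`
(`c₁` before `c₂` under `θ`), leaves `L₁` incident to `c₁` and `L₂` incident to `c₂`. -/
def Super2NebCommon (θ : Equiv.Perm (Fin n)) (S : Finset (Fin n)) (c₁ c₂ : Fin n)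
    (L₁ L₂ : Finset (Fin n)) : Prop :=
  L₁.Nonempty ∧ L₂.Nonempty ∧ Disjoint L₁ L₂ ∧
  c₁ ∉ L₁ ∪ L₂ ∧ c₂ ∉ L₁ ∪ L₂ ∧ c₁ ≠ c₂ ∧
  S = insert c₁ (insert c₂ (L₁ ∪ L₂)) ∧ pos θ c₁ < pos θ c₂

/-- `S` is a super (left/middle/right) 2-nebula of `T` under `θ`, with centers `c₁, c₂` and
leaves `L₁` (incident to `c₁`) and `L₂` (incident to `c₂`). -/
def IsSuper2NebulaAt (T : Tournament n) (θ : Equiv.Perm (Fin n)) (S : Finset (Fin n))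
    (c₁ c₂ : Fin n) (L₁ L₂ : Finset (Fin n)) : NebKind → Prop
  | NebKind.middle =>
      Super2NebCommon θ S c₁ c₂ L₁ L₂ ∧
      (∀ v ∈ L₁ ∪ L₂, pos θ c₁ < pos θ v ∧ pos θ v < pos θ c₂) ∧
      (∀ v ∈ L₁, T.adj v c₁) ∧ (∀ v ∈ L₂, T.adj c₂ v) ∧ T.adj c₂ c₁ ∧
      (∀ u ∈ S, ∀ v ∈ S, T.Backward θ u v →
        (u ∈ L₁ ∧ v = c₁) ∨ (u = c₂ ∧ v ∈ L₂) ∨ (u = c₂ ∧ v = c₁))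
  | NebKind.left =>
      Super2NebCommon θ S c₁ c₂ L₁ L₂ ∧
      (∀ v ∈ L₁ ∪ L₂, pos θ v < pos θ c₁) ∧
      (∀ v ∈ L₁, T.adj c₁ v) ∧ (∀ v ∈ L₂, T.adj c₂ v) ∧ T.adj c₂ c₁ ∧
      (∀ u ∈ S, ∀ v ∈ S, T.Backward θ u v →
        (u = c₁ ∧ v ∈ L₁) ∨ (u = c₂ ∧ v ∈ L₂) ∨ (u = c₂ ∧ v = c₁))
  | NebKind.right =>
      Super2NebCommon θ S c₁ c₂ L₁ L₂ ∧
      (∀ v ∈ L₁ ∪ L₂, pos θ c₂ < pos θ v) ∧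
      (∀ v ∈ L₁, T.adj v c₁) ∧ (∀ v ∈ L₂, T.adj v c₂) ∧ T.adj c₂ c₁ ∧
      (∀ u ∈ S, ∀ v ∈ S, T.Backward θ u v →
        (u ∈ L₁ ∧ v = c₁) ∨ (u ∈ L₂ ∧ v = c₂) ∨ (u = c₂ ∧ v = c₁))

/-- A decomposition of `T` witnessing that `T` is a super nebula under `θ`, with stars
`Q i` (centers `ctr i`) and super 2-nebulas `Sig i` (centers `c₁ i, c₂ i`, leaves
`L₁ i, L₂ i`, of kind `kd i`). -/
def SuperNebulaDecomp (T : Tournament n) (θ : Equiv.Perm (Fin n)) {m l : ℕ}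
    (Q : Fin m → Finset (Fin n)) (ctr : Fin m → Fin n)
    (Sig : Fin l → Finset (Fin n)) (c₁ c₂ : Fin l → Fin n)
    (L₁ L₂ : Fin l → Finset (Fin n)) (kd : Fin l → NebKind) : Prop :=
  (∀ i, T.IsStarAt θ (Q i) (ctr i)) ∧
  (∀ i, T.IsSuper2NebulaAt θ (Sig i) (c₁ i) (c₂ i) (L₁ i) (L₂ i) (kd i)) ∧
  (∀ i j, i ≠ j → Disjoint (Q i) (Q j)) ∧
  (∀ i j, i ≠ j → Disjoint (Sig i) (Sig j)) ∧
  (∀ i j, Disjoint (Q i) (Sig j)) ∧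
  (∀ u v, T.Backward θ u v → (∃ i, u ∈ Q i ∧ v ∈ Q i) ∨ (∃ i, u ∈ Sig i ∧ v ∈ Sig i)) ∧
  (∀ i j, ¬ BetweenSet θ (L₁ j ∪ L₂ j) (ctr i)) ∧
  (∀ i j, i ≠ j → ¬ BetweenSet θ (L₁ j ∪ L₂ j) (c₁ i) ∧ ¬ BetweenSet θ (L₁ j ∪ L₂ j) (c₂ i))

/-- `T` is a super nebula. -/
def IsSuperNebula (T : Tournament n) : Prop :=
  ∃ (θ : Equiv.Perm (Fin n)) (m l : ℕ) (Q : Fin m → Finset (Fin n)) (ctr : Fin m → Fin n)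
    (Sig : Fin l → Finset (Fin n)) (c₁ c₂ : Fin l → Fin n)
    (L₁ L₂ : Fin l → Finset (Fin n)) (kd : Fin l → NebKind),
    SuperNebulaDecomp T θ Q ctr Sig c₁ c₂ L₁ L₂ kd

/-- `{a, b, c}` (in this position order) is a triangle of `T` under `θ`:
`a` is the left exterior, `b` the center, `c` the right exterior. -/
def IsTriangleAt (T : Tournament n) (θ : Equiv.Perm (Fin n)) (a b c : Fin n) : Prop :=
  pos θ a < pos θ b ∧ pos θ b < pos θ c ∧ T.adj b a ∧ T.adj c a ∧ T.adj c b

/-- A decomposition of `T` under `θ` into triangles `{A i, B i, C i}` (left exterior, center,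
right exterior) and frontier stars `Q j` with centers `ctr j`, where for each triangle `i`,
the vertices in `forb i` are not allowed to lie between leaves of a star. -/
def TriGalaxyDecomp (T : Tournament n) (θ : Equiv.Perm (Fin n)) {l k : ℕ}
    (A B C : Fin l → Fin n) (Q : Fin k → Finset (Fin n)) (ctr : Fin k → Fin n)
    (forb : Fin l → Finset (Fin n)) : Prop :=
  (∀ i, T.IsTriangleAt θ (A i) (B i) (C i)) ∧
  (∀ j, T.IsFrontierStarAt θ (Q j) (ctr j)) ∧
  (∀ i j, i ≠ j →
    Disjoint ({A i, B i, C i} : Finset (Fin n)) ({A j, B j, C j} : Finset (Fin n))) ∧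
  (∀ i j, Disjoint ({A i, B i, C i} : Finset (Fin n)) (Q j)) ∧
  (∀ i j, i ≠ j → Disjoint (Q i) (Q j)) ∧
  (∀ u v, T.Backward θ u v →
    (∃ i, u ∈ ({A i, B i, C i} : Finset (Fin n)) ∧ v ∈ ({A i, B i, C i} : Finset (Fin n))) ∨
    (∃ j, u ∈ Q j ∧ v ∈ Q j)) ∧
  (∀ i j, i ≠ j → ¬ BetweenSet θ ((Q j).erase (ctr j)) (ctr i)) ∧
  (∀ i j, ∀ x ∈ forb i, ¬ BetweenSet θ ((Q j).erase (ctr j)) x)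

/-- `T` is a Δgalaxy: a triangular galaxy with exactly one triangle. -/
def IsDeltaGalaxy (T : Tournament n) : Prop :=
  ∃ (θ : Equiv.Perm (Fin n)) (a b c : Fin n) (k : ℕ)
    (Q : Fin k → Finset (Fin n)) (ctr : Fin k → Fin n),
    TriGalaxyDecomp T θ (fun _ : Fin 1 => a) (fun _ => b) (fun _ => c) Q ctr
      (fun _ => ({a, b, c} : Finset (Fin n)))

/-- `T` is a central triangular galaxy: centers of triangles may lie between leaves of stars. -/
def IsCentralTriangularGalaxy (T : Tournament n) : Prop :=
  ∃ (θ : Equiv.Perm (Fin n)) (l k : ℕ) (A B C : Fin l → Fin n)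
    (Q : Fin k → Finset (Fin n)) (ctr : Fin k → Fin n),
    TriGalaxyDecomp T θ A B C Q ctr (fun i => ({A i, C i} : Finset (Fin n)))

/-- `T` is a left triangular galaxy: left exteriors of triangles may lie between leaves. -/
def IsLeftTriangularGalaxy (T : Tournament n) : Prop :=
  ∃ (θ : Equiv.Perm (Fin n)) (l k : ℕ) (A B C : Fin l → Fin n)
    (Q : Fin k → Finset (Fin n)) (ctr : Fin k → Fin n),
    TriGalaxyDecomp T θ A B C Q ctr (fun i => ({B i, C i} : Finset (Fin n)))

/-- `T` is a right triangular galaxy: right exteriors of triangles may lie between leaves. -/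
def IsRightTriangularGalaxy (T : Tournament n) : Prop :=
  ∃ (θ : Equiv.Perm (Fin n)) (l k : ℕ) (A B C : Fin l → Fin n)
    (Q : Fin k → Finset (Fin n)) (ctr : Fin k → Fin n),
    TriGalaxyDecomp T θ A B C Q ctr (fun i => ({A i, B i} : Finset (Fin n)))

/-- A decomposition of `T` witnessing that `T` is a nebula under `θ` (no condition on the
location of the centers of the stars). -/
def NebulaDecomp (T : Tournament n) (θ : Equiv.Perm (Fin n)) {k : ℕ}
    (Q : Fin k → Finset (Fin n)) (ctr : Fin k → Fin n) : Prop :=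
  (∀ i, T.IsStarAt θ (Q i) (ctr i)) ∧
  (∀ i j, i ≠ j → Disjoint (Q i) (Q j)) ∧
  (∀ u v, T.Backward θ u v → ∃ i, u ∈ Q i ∧ v ∈ Q i)

/-- `T` is a central nebula: a nebula all of whose stars are 3-vertex middle stars. -/
def IsCentralNebula (T : Tournament n) : Prop :=
  ∃ (θ : Equiv.Perm (Fin n)) (k : ℕ) (Q : Fin k → Finset (Fin n)) (ctr : Fin k → Fin n),
    NebulaDecomp T θ Q ctr ∧ ∀ i, T.IsMiddleStarAt θ (Q i) (ctr i) ∧ (Q i).card = 3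

/-- `T` is a super left nebula: a nebula all of whose stars are left stars. -/
def IsSuperLeftNebula (T : Tournament n) : Prop :=
  ∃ (θ : Equiv.Perm (Fin n)) (k : ℕ) (Q : Fin k → Finset (Fin n)) (ctr : Fin k → Fin n),
    NebulaDecomp T θ Q ctr ∧ ∀ i, T.IsLeftStarAt θ (Q i) (ctr i)

/-- `T` is a super right nebula: a nebula all of whose stars are right stars. -/
def IsSuperRightNebula (T : Tournament n) : Prop :=
  ∃ (θ : Equiv.Perm (Fin n)) (k : ℕ) (Q : Fin k → Finset (Fin n)) (ctr : Fin k → Fin n),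
    NebulaDecomp T θ Q ctr ∧ ∀ i, T.IsRightStarAt θ (Q i) (ctr i)

/-- `T` is an LR-Δgalaxy: a super Δgalaxy in which only the two exteriors of the triangle
may lie between leaves of a star. -/
def IsLRDeltaGalaxy (T : Tournament n) : Prop :=
  ∃ (θ : Equiv.Perm (Fin n)) (a b c : Fin n) (k : ℕ)
    (Q : Fin k → Finset (Fin n)) (ctr : Fin k → Fin n),
    TriGalaxyDecomp T θ (fun _ : Fin 1 => a) (fun _ => b) (fun _ => c) Q ctr
      (fun _ => ({b} : Finset (Fin n)))

/-- `T` is a CR-Δgalaxy. -/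
def IsCRDeltaGalaxy (T : Tournament n) : Prop :=
  ∃ (θ : Equiv.Perm (Fin n)) (a b c : Fin n) (k : ℕ)
    (Q : Fin k → Finset (Fin n)) (ctr : Fin k → Fin n),
    TriGalaxyDecomp T θ (fun _ : Fin 1 => a) (fun _ => b) (fun _ => c) Q ctr
      (fun _ => ({a} : Finset (Fin n))) ∧
    (∀ i j, i ≠ j → BetweenSet θ ((Q i).erase (ctr i)) b →
      BetweenSet θ ((Q j).erase (ctr j)) c →
      (∀ x ∈ (Q i).erase (ctr i), ¬ BetweenSet θ ((Q j).erase (ctr j)) x) ∧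
      (∀ x ∈ (Q j).erase (ctr j), ¬ BetweenSet θ ((Q i).erase (ctr i)) x)) ∧
    (∀ i, BetweenSet θ ((Q i).erase (ctr i)) b → ¬ BetweenSet θ ((Q i).erase (ctr i)) c)

/-- `T` is a CL-Δgalaxy. -/
def IsCLDeltaGalaxy (T : Tournament n) : Prop :=
  ∃ (θ : Equiv.Perm (Fin n)) (a b c : Fin n) (k : ℕ)
    (Q : Fin k → Finset (Fin n)) (ctr : Fin k → Fin n),
    TriGalaxyDecomp T θ (fun _ : Fin 1 => a) (fun _ => b) (fun _ => c) Q ctr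
      (fun _ => ({c} : Finset (Fin n))) ∧
    (∀ i j, i ≠ j → BetweenSet θ ((Q i).erase (ctr i)) b →
      BetweenSet θ ((Q j).erase (ctr j)) a →
      (∀ x ∈ (Q i).erase (ctr i), ¬ BetweenSet θ ((Q j).erase (ctr j)) x) ∧
      (∀ x ∈ (Q j).erase (ctr j), ¬ BetweenSet θ ((Q i).erase (ctr i)) x)) ∧
    (∀ i, BetweenSet θ ((Q i).erase (ctr i)) b → ¬ BetweenSet θ ((Q i).erase (ctr i)) a)

/-- A decomposition of `T` under `θ` into one super 2-nebula (of kind `kd`) and frontier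
stars, covering all of `V(T)`, witnessing that `T` is a Σ-galaxy under `θ`. -/
def SigmaGalaxyDecomp (T : Tournament n) (θ : Equiv.Perm (Fin n))
    (S : Finset (Fin n)) (c₁ c₂ : Fin n) (L₁ L₂ : Finset (Fin n)) (kd : NebKind)
    {m : ℕ} (Q : Fin m → Finset (Fin n)) (ctr : Fin m → Fin n) : Prop :=
  T.IsSuper2NebulaAt θ S c₁ c₂ L₁ L₂ kd ∧
  (∀ j, T.IsFrontierStarAt θ (Q j) (ctr j)) ∧
  (∀ i j, i ≠ j → Disjoint (Q i) (Q j)) ∧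
  (∀ j, Disjoint S (Q j)) ∧
  (∀ v, v ∈ S ∨ ∃ j, v ∈ Q j) ∧
  (∀ u v, T.Backward θ u v → (u ∈ S ∧ v ∈ S) ∨ ∃ j, u ∈ Q j ∧ v ∈ Q j) ∧
  (∀ j, ¬ BetweenSet θ (L₁ ∪ L₂) (ctr j)) ∧
  (∀ j, ¬ BetweenSet θ ((Q j).erase (ctr j)) c₁ ∧ ¬ BetweenSet θ ((Q j).erase (ctr j)) c₂) ∧
  (∀ i j, i ≠ j → ¬ BetweenSet θ ((Q j).erase (ctr j)) (ctr i))

def IsMiddleSigmaGalaxy (T : Tournament n) : Prop :=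
  ∃ (θ : Equiv.Perm (Fin n)) (S : Finset (Fin n)) (c₁ c₂ : Fin n) (L₁ L₂ : Finset (Fin n))
    (m : ℕ) (Q : Fin m → Finset (Fin n)) (ctr : Fin m → Fin n),
    SigmaGalaxyDecomp T θ S c₁ c₂ L₁ L₂ NebKind.middle Q ctr

def IsLeftSigmaGalaxy (T : Tournament n) : Prop :=
  ∃ (θ : Equiv.Perm (Fin n)) (S : Finset (Fin n)) (c₁ c₂ : Fin n) (L₁ L₂ : Finset (Fin n))
    (m : ℕ) (Q : Fin m → Finset (Fin n)) (ctr : Fin m → Fin n),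
    SigmaGalaxyDecomp T θ S c₁ c₂ L₁ L₂ NebKind.left Q ctr

def IsRightSigmaGalaxy (T : Tournament n) : Prop :=
  ∃ (θ : Equiv.Perm (Fin n)) (S : Finset (Fin n)) (c₁ c₂ : Fin n) (L₁ L₂ : Finset (Fin n))
    (m : ℕ) (Q : Fin m → Finset (Fin n)) (ctr : Fin m → Fin n),
    SigmaGalaxyDecomp T θ S c₁ c₂ L₁ L₂ NebKind.right Q ctr

/-- The directed density from `X` to `Y`. -/
noncomputable def density (T : Tournament n) (X Y : Finset (Fin n)) : ℝ :=
  (Set.ncard {p : Fin n × Fin n | p.1 ∈ X ∧ p.2 ∈ Y ∧ T.adj p.1 p.2} : ℝ) /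
    ((X.card : ℝ) * (Y.card : ℝ))

/-- `(S i)` is a smooth `(c, lam, w)`-structure of `T`. -/
def IsSmoothStructure (T : Tournament n) (c lam : ℝ) {N : ℕ} (w : Fin N → Bool)
    (S : Fin N → Finset (Fin n)) : Prop :=
  (∀ i j, i ≠ j → Disjoint (S i) (S j)) ∧
  (∀ i, w i = false → c * (n : ℝ) ≤ ((S i).card : ℝ)) ∧
  (∀ i, w i = true → T.IsTransOn (S i) ∧ c * (T.trSize : ℝ) ≤ ((S i).card : ℝ)) ∧
  (∀ i j, i < j →
    (∀ v ∈ S i, 1 - lam ≤ T.density {v} (S j)) ∧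
    (∀ v ∈ S j, 1 - lam ≤ T.density (S i) {v}))

end Tournament

/-- The backward arcs of `K₆` under its canonical ordering. -/
def K6back : List (ℕ × ℕ) := [(3, 0), (5, 2), (5, 0), (4, 1)]

/-- The tournament `K₆`, on `Fin 6` with its canonical ordering. -/
def K6 : Tournament 6 where
  adj u v := (u.val, v.val) ∈ K6back ∨ (u < v ∧ (v.val, u.val) ∉ K6back)
  asymm := by decide
  total := by decide

/-- The pair `{H₁, H₂}` satisfies the Erdős–Hajnal conjecture: there is `ε > 0` such that
every `{H₁, H₂}`-free tournament `T` has a transitive subtournament of size `≥ |T| ^ ε`. -/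
def EHPair {n₁ n₂ : ℕ} (H₁ : Tournament n₁) (H₂ : Tournament n₂) : Prop :=
  ∃ ε : ℝ, 0 < ε ∧ ∀ (n : ℕ) (T : Tournament n),
    ¬ T.Contains H₁ → ¬ T.Contains H₂ → (n : ℝ) ^ ε ≤ (T.trSize : ℝ)

open Tournament

section

open scoped Classical

namespace Finset

variable {α β ι : Type*}

/-- If each of at most `K` conditions fails on at most a `1 / (2 * K)` fraction of `A`, then at
least half of `A` satisfies all of them. -/
theorem exists_half_forall {A : Finset α} {J : Finset ι} {p : ι → α → Prop}
    {K : ℕ} (hJ : #J ≤ K) (h : ∀ j ∈ J, ∀ D ⊆ A, (∀ a ∈ D, ¬ p j a) → 2 * K * #D ≤ #A) :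
    ∃ A₀ ⊆ A, #A ≤ 2 * #A₀ ∧ ∀ a ∈ A₀, ∀ j ∈ J, p j a := by
  refine ⟨{a ∈ A | ∀ j ∈ J, p j a}, filter_subset _ _, ?_, fun a ha => (mem_filter.1 ha).2⟩
  have h1 : #{a ∈ A | ¬ ∀ j ∈ J, p j a} ≤ ∑ j ∈ J, #{a ∈ A | ¬ p j a} := by
    refine (card_le_card ?_).trans card_biUnion_le
    intro a ha
    simp only [mem_filter, not_forall, mem_biUnion] at ha ⊢
    obtain ⟨ha, j, hj, hp⟩ := ha
    exact ⟨j, hj, ha, hp⟩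
  have h2 : 2 * K * ∑ j ∈ J, #{a ∈ A | ¬ p j a} ≤ K * #A := by
    rw [mul_sum]
    calc _ ≤ ∑ j ∈ J, #A := sum_le_sum fun j hj =>
          h j hj _ (filter_subset _ _) fun a ha => (mem_filter.1 ha).2
      _ = #J * #A := by simp
      _ ≤ K * #A := Nat.mul_le_mul_right _ hJ
  have h3 := card_filter_add_card_filter_not (s := A) (fun a => ∀ j ∈ J, p j a)
  rcases Nat.eq_zero_or_pos K with rfl | hK
  · have : J = ∅ := by simpa using hJ
    subst this
    simp only [notMem_empty, IsEmpty.forall_iff, implies_true, filter_true]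
    omega
  · have h4 : 2 * ∑ j ∈ J, #{a ∈ A | ¬ p j a} ≤ #A := by
      refine Nat.le_of_mul_le_mul_left ?_ hK
      calc _ = 2 * K * ∑ j ∈ J, #{a ∈ A | ¬ p j a} := by ring
        _ ≤ _ := h2
    omega

/-- Bounds on the average degrees from `A` into the sets `Y j` give bounds on all degrees after
passing to at least half of `A`. -/
theorem exists_half_forall_degree_le {A : Finset α} {J : Finset ι} {Y : ι → Finset β}
    {r : ι → α → β → Prop} [∀ j a y, Decidable (r j a y)] {K M : ℕ} (hJ : #J ≤ K)
    (h : ∀ j ∈ J, 2 * K * M * ∑ a ∈ A, #{y ∈ Y j | r j a y} ≤ #A * #(Y j)) :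
    ∃ A₀ ⊆ A, #A ≤ 2 * #A₀ ∧ ∀ a ∈ A₀, ∀ j ∈ J, M * #{y ∈ Y j | r j a y} ≤ #(Y j) := by
  refine exists_half_forall hJ fun j hj D hDA hD => ?_
  have h1 : #D * (#(Y j) + 1) ≤ M * ∑ a ∈ A, #{y ∈ Y j | r j a y} := by
    calc #D * (#(Y j) + 1) = ∑ a ∈ D, (#(Y j) + 1) := by simp
      _ ≤ ∑ a ∈ D, M * #{y ∈ Y j | r j a y} := by
        refine sum_le_sum fun a ha => ?_
        have := hD a ha
        omega
      _ ≤ ∑ a ∈ A, M * #{y ∈ Y j | r j a y} := sum_le_sum_of_subset hDA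
      _ = _ := by rw [mul_sum]
  have h2 : 2 * K * #D * (#(Y j) + 1) ≤ #A * (#(Y j) + 1) := by
    calc 2 * K * #D * (#(Y j) + 1) = 2 * K * (#D * (#(Y j) + 1)) := by ring
      _ ≤ 2 * K * (M * ∑ a ∈ A, #{y ∈ Y j | r j a y}) := Nat.mul_le_mul_left _ h1
      _ = 2 * K * M * ∑ a ∈ A, #{y ∈ Y j | r j a y} := by ring
      _ ≤ #A * #(Y j) := h j hj
      _ ≤ #A * (#(Y j) + 1) := Nat.mul_le_mul_left _ (Nat.le_succ _)
  exact Nat.le_of_mul_le_mul_right h2 (Nat.succ_pos _)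

theorem exists_disjoint_subsets_card_eq (q : ℕ) :
    ∀ (h : ℕ) (X : Finset α), h * q ≤ #X →
      ∃ V : Fin h → Finset α, (∀ i, V i ⊆ X ∧ #(V i) = q) ∧
        ∀ i j, i ≠ j → Disjoint (V i) (V j)
  | 0, X, _ => ⟨fun _ => ∅, fun i => i.elim0, fun i => i.elim0⟩
  | h + 1, X, hX => by
    rw [Nat.succ_mul] at hX
    obtain ⟨A, hAX, hA⟩ := exists_subset_card_eq (show q ≤ #X by omega)
    have hc := card_sdiff_add_card_eq_card hAX
    obtain ⟨V, hV, hd⟩ := exists_disjoint_subsets_card_eq q h (X \ A) (by omega)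
    have hAV : ∀ i, Disjoint A (V i) := fun i =>
      (disjoint_sdiff_self_right).mono_right (hV i).1
    refine ⟨Fin.cons A V, ?_, ?_⟩
    · refine Fin.cases ⟨hAX, hA⟩ fun i => ?_
      exact ⟨(hV i).1.trans sdiff_subset, (hV i).2⟩
    · intro i j hij
      cases i using Fin.cases with
      | zero =>
        cases j using Fin.cases with
        | zero => exact (hij rfl).elim
        | succ j => simpa using hAV j
      | succ i =>
        cases j using Fin.cases with
        | zero => simpa using (hAV i).symm
        | succ j => simpa using hd i j (fun h => hij (by rw [h]))

end Finset

namespace Tournament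

variable {n N h : ℕ}

theorem adj_irrefl (T : Tournament n) (u : Fin n) : ¬ T.adj u u := fun h => T.asymm _ _ h h

theorem adj_of_not_adj (T : Tournament n) {u v : Fin n} (huv : u ≠ v) (h : ¬ T.adj u v) :
    T.adj v u := (T.total u v huv).resolve_left h

theorem contains_of_adj {T : Tournament N} {H : Tournament n} (f : Fin n → Fin N)
    (hf : ∀ u v, H.adj u v → T.adj (f u) (f v)) : T.Contains H := by
  refine ⟨⟨f, fun u v huv => ?_⟩, fun u v => ⟨hf u v, fun hT => ?_⟩⟩
  · by_contra hne
    rcases H.total u v hne with h | h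
    · exact T.adj_irrefl _ (huv ▸ hf _ _ h)
    · exact T.adj_irrefl _ (huv ▸ hf _ _ h)
  · by_contra hH
    refine T.asymm _ _ hT (hf _ _ (H.adj_of_not_adj ?_ hH))
    rintro rfl
    exact T.adj_irrefl _ hT

/-- The number of pairs in `A × B` which are not arcs from `A` to `B`. -/
noncomputable def nonArcs (T : Tournament N) (A B : Finset (Fin N)) : ℕ :=
  ∑ a ∈ A, #{b ∈ B | ¬ T.adj a b}

theorem nonArcs_comm (T : Tournament N) (A B : Finset (Fin N)) :
    T.nonArcs A B = ∑ b ∈ B, #{a ∈ A | ¬ T.adj a b} :=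
  Finset.sum_card_bipartiteAbove_eq_sum_card_bipartiteBelow fun a b => ¬ T.adj a b

/-- If no pair of disjoint large subsets of `X` is almost complete in one direction, then every
pattern can be embedded greedily into large disjoint subsets of `X`. -/
theorem exists_embedding_of_dense (T : Tournament N) {M m H : ℕ} (hM : 0 < M)
    {X : Finset (Fin N)}
    (hX : ∀ A ⊆ X, ∀ B ⊆ X, Disjoint A B → m ≤ #A → m ≤ #B → #A * #B < M * T.nonArcs A B) :
    ∀ (h : ℕ) (R : Fin h → Fin h → Prop) (V : Fin h → Finset (Fin N)), h ≤ H →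
      (∀ i, V i ⊆ X) → (∀ i j, i ≠ j → Disjoint (V i) (V j)) →
      (∀ i, M ^ h * (H * m + 1) ≤ #(V i)) →
      ∃ f : Fin h → Fin N, (∀ i, f i ∈ V i) ∧ ∀ i j, i < j →
        (R i j → T.adj (f i) (f j)) ∧ (¬ R i j → T.adj (f j) (f i))
  | 0, R, V, _, _, _, _ => ⟨fun i => i.elim0, fun i => i.elim0, fun i => i.elim0⟩
  | h + 1, R, V, hH, hV, hd, hc => by
    have hbig : ∀ i, H * m + 1 ≤ #(V i) := fun i =>
      (Nat.le_mul_of_pos_left _ (pow_pos hM _)).trans (hc i)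
    have hm : m ≤ H * m := Nat.le_mul_of_pos_left _ (by omega)
    let nb (v : Fin N) (i : Fin h) : Finset (Fin N) :=
      {y ∈ V i.succ | (R 0 i.succ → T.adj v y) ∧ (¬ R 0 i.succ → T.adj y v)}
    have hbad : ∀ i : Fin h, #{v ∈ V 0 | ¬ #(V i.succ) ≤ M * #(nb v i)} ≤ m := by
      intro i
      by_contra hlt
      set D := {v ∈ V 0 | ¬ #(V i.succ) ≤ M * #(nb v i)} with hD
      rw [not_le] at hlt
      have hDV : D ⊆ V 0 := filter_subset _ _
      have hdis : Disjoint D (V i.succ) := (hd 0 i.succ (Fin.succ_ne_zero i).symm).mono_left hDV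
      have hne : ∀ v ∈ D, ∀ y ∈ V i.succ, v ≠ y := fun v hv y hy hvy =>
        disjoint_left.1 hdis hv (hvy ▸ hy)
      have hbd : M * ∑ v ∈ D, #(nb v i) ≤ #D * #(V i.succ) := by
        rw [mul_sum]
        calc _ ≤ ∑ v ∈ D, #(V i.succ) := sum_le_sum fun v hv => by
              have := (mem_filter.1 hv).2
              omega
          _ = _ := by simp
      have hVm : m ≤ #(V i.succ) := by have := hbig i.succ; omega
      by_cases hR : R 0 i.succ
      · have h1 := hX (V i.succ) (hV _) D (hDV.trans (hV _)) hdis.symm hVm hlt.le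
        rw [nonArcs_comm] at h1
        have h2 : ∑ v ∈ D, #{y ∈ V i.succ | ¬ T.adj y v} ≤ ∑ v ∈ D, #(nb v i) := by
          refine sum_le_sum fun v hv => card_le_card fun y hy => ?_
          simp only [mem_filter, nb] at hy ⊢
          exact ⟨hy.1, fun _ => T.adj_of_not_adj (hne v hv y hy.1).symm hy.2,
            fun h => (h hR).elim⟩
        have h3 := Nat.mul_le_mul_left M h2
        rw [mul_comm #(V i.succ)] at h1
        omega
      · have h1 := hX D (hDV.trans (hV _)) (V i.succ) (hV _) hdis hlt.le hVm
        have h2 : T.nonArcs D (V i.succ) ≤ ∑ v ∈ D, #(nb v i) := by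
          refine sum_le_sum fun v hv => card_le_card fun y hy => ?_
          simp only [mem_filter, nb] at hy ⊢
          exact ⟨hy.1, fun h => (hR h).elim,
            fun _ => T.adj_of_not_adj (hne v hv y hy.1) hy.2⟩
        have h3 := Nat.mul_le_mul_left M h2
        omega
    obtain ⟨v, hv0, hv⟩ : ∃ v ∈ V 0, ∀ i : Fin h, #(V i.succ) ≤ M * #(nb v i) := by
      by_contra! hno
      have h1 : V 0 ⊆ univ.biUnion fun i : Fin h =>
          {v ∈ V 0 | ¬ #(V i.succ) ≤ M * #(nb v i)} := by
        intro v hv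
        obtain ⟨i, hi⟩ := hno v hv
        exact mem_biUnion.2 ⟨i, mem_univ _, mem_filter.2 ⟨hv, by omega⟩⟩
      have h2 := (card_le_card h1).trans card_biUnion_le
      have h3 : ∑ i : Fin h, #{v ∈ V 0 | ¬ #(V i.succ) ≤ M * #(nb v i)} ≤ h * m :=
        (sum_le_sum fun i _ => hbad i).trans (by simp)
      have h4 : h * m ≤ H * m := Nat.mul_le_mul_right _ (by omega)
      have := hbig 0
      omega
    have hnb : ∀ i, nb v i ⊆ V i.succ := fun i => filter_subset _ _
    obtain ⟨f, hf, hfa⟩ := exists_embedding_of_dense T hM hX h (fun i j => R i.succ j.succ)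
      (nb v) (Nat.le_of_succ_le hH) (fun i => (hnb i).trans (hV _))
      (fun i j hij => (hd i.succ j.succ (fun h => hij (Fin.succ_injective _ h))).mono
        (hnb i) (hnb j))
      (fun i => by
        refine Nat.le_of_mul_le_mul_left ?_ hM
        calc M * (M ^ h * (H * m + 1)) = M ^ (h + 1) * (H * m + 1) := by ring
          _ ≤ #(V i.succ) := hc _
          _ ≤ _ := hv i)
    refine ⟨Fin.cons v f, Fin.cases hv0 fun i => hnb i (hf i), ?_⟩
    intro i j hij
    cases i using Fin.cases with
    | zero =>
      cases j using Fin.cases with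
      | zero => exact (lt_irrefl _ hij).elim
      | succ j => simpa using (mem_filter.1 (hf j)).2
    | succ i =>
      cases j using Fin.cases with
      | zero => exact (Fin.not_lt_zero _ hij).elim
      | succ j => simpa using hfa i j (Fin.succ_lt_succ_iff.1 hij)

/-- In a tournament not containing `H`, every large set contains two linear-sized disjoint subsets
with almost all arcs directed from the first to the second. -/
theorem exists_almost_complete_pair (H : Tournament h) {M : ℕ} (hM : 0 < M) :
    ∃ C : ℕ, 0 < C ∧ ∀ {N : ℕ} (T : Tournament N), ¬ T.Contains H →
      ∀ X : Finset (Fin N), C ≤ #X → ∃ A ⊆ X, ∃ B ⊆ X, Disjoint A B ∧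
        #X ≤ C * #A ∧ #X ≤ C * #B ∧ M * T.nonArcs A B ≤ #A * #B := by
  have hMh : 0 < M ^ h := pow_pos hM h
  refine ⟨2 * ((h + 1) * (M ^ h * (h + 1))), by positivity, fun T hT X hX => ?_⟩
  set C := 2 * ((h + 1) * (M ^ h * (h + 1))) with hC
  have hC0 : 0 < C := by positivity
  by_contra! hno
  set m := #X / C + 1 with hm
  have hXm : #X < C * m := Nat.lt_mul_div_succ _ hC0
  have hmX : C * m ≤ 2 * #X := by
    have := Nat.mul_div_le #X C
    rw [hm, mul_add, mul_one]
    omega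
  have hq : (h + 1) * (M ^ h * (h * m + 1)) ≤ #X := by
    have h1 : h * m + 1 ≤ (h + 1) * m := by
      rw [Nat.succ_mul]
      exact Nat.add_le_add_left (Nat.succ_pos _) _
    have h2 := Nat.mul_le_mul_left (h + 1) (Nat.mul_le_mul_left (M ^ h) h1)
    have h3 : C * m = 2 * ((h + 1) * (M ^ h * ((h + 1) * m))) := by rw [hC]; ring
    exact h2.trans (Nat.le_of_mul_le_mul_left (h3 ▸ hmX) two_pos)
  obtain ⟨V, hV, hd⟩ := exists_disjoint_subsets_card_eq (M ^ h * (h * m + 1)) h X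
    ((Nat.mul_le_mul_right _ (Nat.le_succ h)).trans hq)
  obtain ⟨f, -, hf⟩ := T.exists_embedding_of_dense (m := m) (H := h) hM (X := X)
    (fun A hA B hB hAB hmA hmB => hno A hA B hB hAB
      (hXm.le.trans (Nat.mul_le_mul_left _ hmA)) (hXm.le.trans (Nat.mul_le_mul_left _ hmB)))
    h H.adj V le_rfl (fun i => (hV i).1) hd (fun i => (hV i).2.ge)
  refine hT (contains_of_adj f fun u v huv => ?_)
  rcases lt_trichotomy u v with hlt | rfl | hlt
  · exact (hf u v hlt).1 huv
  · exact (H.adj_irrefl _ huv).elim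
  · exact (hf v u hlt).2 (H.asymm _ _ huv)

theorem IsTransOn.mono {T : Tournament N} {s t : Finset (Fin N)} (ht : T.IsTransOn t)
    (hst : s ⊆ t) : T.IsTransOn s :=
  fun u hu v hv w hw => ht u (hst hu) v (hst hv) w (hst hw)

theorem bddAbove_card_trans (T : Tournament N) (s : Finset (Fin N)) :
    BddAbove {k | ∃ t, t ⊆ s ∧ T.IsTransOn t ∧ #t = k} :=
  ⟨#s, by rintro _ ⟨t, hts, -, rfl⟩; exact card_le_card hts⟩

theorem IsTransOn.card_le {T : Tournament N} {s t : Finset (Fin N)} (ht : T.IsTransOn t)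
    (hts : t ⊆ s) : #t ≤ T.trSizeOn s :=
  le_csSup (T.bddAbove_card_trans s) ⟨t, hts, ht, rfl⟩

theorem exists_card_eq_trSizeOn (T : Tournament N) (s : Finset (Fin N)) :
    ∃ t ⊆ s, T.IsTransOn t ∧ #t = T.trSizeOn s :=
  Nat.sSup_mem (s := {k | ∃ t, t ⊆ s ∧ T.IsTransOn t ∧ #t = k})
    ⟨0, ∅, empty_subset _, by simp [IsTransOn], rfl⟩ (T.bddAbove_card_trans s)

/-- Quantitative consequences, up to the constant `C`, of `T` being `ε`-critical on `s` for a
small `ε`. -/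
structure IsRich (T : Tournament N) (s : Finset (Fin N)) (C : ℕ) : Prop where
  le_card : C ≤ #s
  le_trSizeOn : C ≤ T.trSizeOn s
  exists_trans : ∀ X ⊆ s, #s ≤ C * #X → ∃ R ⊆ X, T.IsTransOn R ∧ T.trSizeOn s ≤ 2 * #R
  not_complete : ∀ X ⊆ s, ∀ Y ⊆ s, #s ≤ C * #X → T.IsTransOn Y → T.trSizeOn s ≤ C * #Y →
    (∃ x ∈ X, ∃ y ∈ Y, ¬ T.adj x y) ∧ ∃ x ∈ X, ∃ y ∈ Y, ¬ T.adj y x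

theorem IsRich.mono {T : Tournament N} {s : Finset (Fin N)} {C C' : ℕ} (h : T.IsRich s C)
    (hC : C' ≤ C) : T.IsRich s C' where
  le_card := hC.trans h.le_card
  le_trSizeOn := hC.trans h.le_trSizeOn
  exists_trans X hX hc := h.exists_trans X hX (hc.trans (Nat.mul_le_mul_right _ hC))
  not_complete X hX Y hY hcX hYt hcY := h.not_complete X hX Y hY
    (hcX.trans (Nat.mul_le_mul_right _ hC)) hYt (hcY.trans (Nat.mul_le_mul_right _ hC))

/-- The set `Y` is large in `s`: linear-sized if `i` is odd, and transitive of near-maximum size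
if `i` is even. -/
structure IsBlock (T : Tournament N) (s : Finset (Fin N)) (C i : ℕ) (Y : Finset (Fin N)) :
    Prop where
  subset : Y ⊆ s
  linear : i % 2 = 1 → #s ≤ C * #Y
  trans : i % 2 = 0 → T.IsTransOn Y ∧ T.trSizeOn s ≤ C * #Y

theorem IsBlock.mono {T : Tournament N} {s Y Z : Finset (Fin N)} {C C' c i : ℕ}
    (h : T.IsBlock s C i Y) (hZ : Z ⊆ Y) (hc : #Y ≤ c * #Z) (hC : C * c ≤ C') :
    T.IsBlock s C' i Z := by
  have key : C * #Y ≤ C' * #Z := calc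
    C * #Y ≤ C * (c * #Z) := Nat.mul_le_mul_left _ hc
    _ = C * c * #Z := by ring
    _ ≤ C' * #Z := Nat.mul_le_mul_right _ hC
  exact ⟨hZ.trans h.subset, fun hi => (h.linear hi).trans key,
    fun hi => ⟨(h.trans hi).1.mono hZ, (h.trans hi).2.trans key⟩⟩

theorem IsBlock.mul_card_pos {T : Tournament N} {s Y : Finset (Fin N)} {C D i : ℕ}
    (hs : T.IsRich s D) (hD : 0 < D) (h : T.IsBlock s C i Y) : 0 < C * #Y := by
  have h1 := hs.le_card
  have h2 := hs.le_trSizeOn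
  rcases Nat.mod_two_eq_zero_or_one i with hi | hi
  · have := (h.trans hi).2
    omega
  · have := h.linear hi
    omega

/-- A rich set in an `H`-free tournament contains arbitrarily long sequences of blocks, whose
pairs are almost complete in the forward direction. -/
theorem exists_block_sequence (H : Tournament h) : ∀ K M D : ℕ, ∃ C : ℕ,
    ∀ {N : ℕ} (T : Tournament N) (s : Finset (Fin N)), T.IsRich s C → ¬ T.Contains H →
      ∀ X ⊆ s, #s ≤ D * #X → ∃ S : ℕ → Finset (Fin N),
        (∀ i < K, S i ⊆ X ∧ T.IsBlock s C i (S i)) ∧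
        ∀ i j, i < j → j < K → Disjoint (S i) (S j) ∧
          M * T.nonArcs (S i) (S j) ≤ #(S i) * #(S j)
  | 0, M, D => ⟨0, fun _ _ _ _ _ _ _ => ⟨fun _ => ∅, by simp, by simp⟩⟩
  | K + 1, M, D => by
    obtain ⟨Cp, hCp, hpair⟩ := exists_almost_complete_pair H
      (M := 2 * 1 * (2 * K * M) + 1) (Nat.succ_pos _)
    obtain ⟨C₁, hseq⟩ := exists_block_sequence H K M (2 * D * Cp)
    refine ⟨C₁ + 2 * D * Cp + 2, fun {N} T s hs hT X hXs hX => ?_⟩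
    have hXC : Cp ≤ #X := by
      have h1 := hs.le_card
      by_contra! hlt
      have h2 : D * #X ≤ D * Cp := Nat.mul_le_mul_left _ hlt.le
      have h3 : 2 * D * Cp = 2 * (D * Cp) := by ring
      omega
    obtain ⟨A, hAX, B, hBX, hAB, hA, hB, hpr⟩ := hpair T hT X hXC
    have hpr' : 2 * 1 * (2 * K * M) * T.nonArcs A B ≤ #A * #B :=
      (Nat.mul_le_mul_right _ (Nat.le_succ _)).trans hpr
    obtain ⟨A₀, hA₀, hAA₀, hdegA⟩ := exists_half_forall_degree_le (A := A)
      (J := ({()} : Finset Unit)) (Y := fun _ => B) (r := fun _ a b => ¬ T.adj a b) (K := 1)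
      (M := 2 * K * M) (by simp) (fun _ _ => hpr')
    have hlin : ∀ Z Z' : Finset (Fin N), #X ≤ Cp * #Z → #Z ≤ 2 * #Z' →
        #s ≤ 2 * D * Cp * #Z' := fun Z Z' h1 h2 => calc
      #s ≤ D * #X := hX
      _ ≤ D * (Cp * (2 * #Z')) :=
        Nat.mul_le_mul_left _ (h1.trans (Nat.mul_le_mul_left _ h2))
      _ = 2 * D * Cp * #Z' := by ring
    obtain ⟨S, hS, hSp⟩ := hseq T s (hs.mono (by omega)) hT A₀ (hA₀.trans (hAX.trans hXs))
      (hlin A A₀ hA hAA₀)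
    obtain ⟨B₀, hB₀, hBB₀, hdegB⟩ := exists_half_forall_degree_le (A := B)
      (J := range K) (Y := S) (r := fun _ b a => ¬ T.adj a b) (K := K) (M := M) (by simp)
      (fun i hi => by
        rw [← nonArcs_comm, nonArcs, mul_sum, mul_comm #B, ← smul_eq_mul #(S i)]
        refine sum_le_card_nsmul _ _ _ fun a ha => ?_
        exact hdegA a ((hS i (mem_range.1 hi)).1 ha) () (by simp))
    obtain ⟨Z, hZB, hZ⟩ : ∃ Z ⊆ B₀, T.IsBlock s (C₁ + 2 * D * Cp + 2) K Z := by
      have hB₀s : B₀ ⊆ s := hB₀.trans (hBX.trans hXs)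
      have hB₀c : #s ≤ (C₁ + 2 * D * Cp + 2) * #B₀ :=
        (hlin B B₀ hB hBB₀).trans (Nat.mul_le_mul_right _ (by omega))
      rcases Nat.mod_two_eq_zero_or_one K with hK | hK
      · obtain ⟨R, hR, hRt, hRc⟩ := hs.exists_trans B₀ hB₀s hB₀c
        exact ⟨R, hR, hR.trans hB₀s, fun h => by omega,
          fun _ => ⟨hRt, hRc.trans (Nat.mul_le_mul_right _ (by omega))⟩⟩
      · exact ⟨B₀, subset_rfl, hB₀s, fun _ => hB₀c, fun h => by omega⟩
    refine ⟨fun i => if i < K then S i else Z, fun i hi => ?_, fun i j hij hj => ?_⟩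
    · dsimp only
      split_ifs with hiK
      · exact ⟨(hS i hiK).1.trans (hA₀.trans hAX),
          (hS i hiK).2.mono (c := 1) subset_rfl (by simp) (by omega)⟩
      · obtain rfl : i = K := by omega
        exact ⟨hZB.trans (hB₀.trans hBX), hZ⟩
    · have hiK : i < K := by omega
      simp only [hiK, if_true]
      split_ifs with hjK
      · exact hSp i j hij hjK
      · refine ⟨hAB.mono ((hS i hiK).1.trans hA₀) (hZB.trans hB₀), ?_⟩
        rw [nonArcs_comm, mul_sum, mul_comm #(S i), ← smul_eq_mul #Z]
        exact sum_le_card_nsmul _ _ _ fun b hb => hdegB b (hZB hb) i (mem_range.2 hiK)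

/-- A transitive set splits into consecutive chunks of comparable size. -/
theorem IsTransOn.exists_chunks {T : Tournament N} {S : Finset (Fin N)} (hS : T.IsTransOn S)
    {p : ℕ} (hp : 0 < p) (hpS : p ≤ #S) : ∃ P : ℕ → Finset (Fin N),
      (∀ j < p, P j ⊆ S ∧ #S ≤ 2 * p * #(P j)) ∧
      ∀ j j', j < j' → ∀ x ∈ P j, ∀ y ∈ P j', T.adj x y := by
  let r (x : Fin N) : ℕ := #{y ∈ S | T.adj y x}
  have hlt : ∀ x ∈ S, ∀ y ∈ S, T.adj x y → r x < r y := fun x hx y hy hxy => by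
    refine card_lt_card ((ssubset_iff_of_subset ?_).2 ⟨x, ?_, ?_⟩)
    · intro z hz
      simp only [mem_filter] at hz ⊢
      exact ⟨hz.1, hS z hz.1 x hx y hy hz.2 hxy⟩
    · exact mem_filter.2 ⟨hx, hxy⟩
    · simp [T.adj_irrefl]
  have hinj : Set.InjOn r S := fun x hx y hy hxy => by
    by_contra hne
    rcases T.total x y hne with h | h
    · exact (hlt x hx y hy h).ne hxy
    · exact (hlt y hy x hx h).ne' hxy
  have himg : S.image r = range #S := by
    refine eq_of_subset_of_card_le (fun k hk => ?_) ?_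
    · obtain ⟨x, hx, rfl⟩ := mem_image.1 hk
      refine mem_range.2 (card_lt_card ((ssubset_iff_of_subset (filter_subset _ _)).2
        ⟨x, hx, by simp [T.adj_irrefl]⟩))
    · rw [card_image_of_injOn hinj, card_range]
  set q := #S / p with hq
  have hq0 : 0 < q := Nat.div_pos hpS hp
  have hdm := Nat.div_add_mod #S p
  have hmod := Nat.mod_lt #S hp
  refine ⟨fun j => {x ∈ S | r x / q = j}, fun j hj => ⟨filter_subset _ _, ?_⟩, ?_⟩
  · have h1 : Ico (j * q) (j * q + q) ⊆ {x ∈ S | r x / q = j}.image r := by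
      intro k hk
      rw [mem_Ico] at hk
      have hkS : k < #S := by
        have h2 : (j + 1) * q ≤ p * q := Nat.mul_le_mul_right _ hj
        rw [Nat.succ_mul] at h2
        rw [← hq] at hdm
        omega
      obtain ⟨x, hx, rfl⟩ := mem_image.1 (himg ▸ mem_range.2 hkS)
      refine mem_image.2 ⟨x, mem_filter.2 ⟨hx, ?_⟩, rfl⟩
      exact Nat.div_eq_of_lt_le hk.1 (by rw [Nat.succ_mul]; exact hk.2)
    have h2 := (card_le_card h1).trans card_image_le
    rw [Nat.card_Ico, Nat.add_sub_cancel_left] at h2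
    calc #S ≤ 2 * p * q := by
          have : p ≤ p * q := Nat.le_mul_of_pos_right _ hq0
          have h3 : 2 * p * q = 2 * (p * q) := by ring
          rw [← hq] at hdm
          omega
      _ ≤ _ := Nat.mul_le_mul_left _ h2
  · intro j j' hjj x hx y hy
    simp only [mem_filter] at hx hy
    by_contra hadj
    have hne : x ≠ y := by
      rintro rfl
      omega
    have h1 := hlt y hy.1 x hx.1 (T.adj_of_not_adj hne hadj)
    have h2 : r y / q ≤ r x / q := Nat.div_le_div_right h1.le
    omega

/-- A doubly indexed family of blocks, where `B i j` for `j < p` are consecutive chunks of one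
transitive set if `i` is even, and where for `i < i'` all vertices have almost all of their arcs
directed from `B i j` to `B i' j'`. -/
structure IsBlockFamily (T : Tournament N) (s : Finset (Fin N)) (K p M C : ℕ)
    (B : ℕ → ℕ → Finset (Fin N)) : Prop where
  block : ∀ i < K, ∀ j < p, T.IsBlock s C i (B i j)
  disjoint : ∀ i < K, ∀ i' < K, i ≠ i' → ∀ j < p, ∀ j' < p, Disjoint (B i j) (B i' j')
  chunk : ∀ i < K, i % 2 = 0 → ∀ j j', j < j' → j' < p →
    ∀ x ∈ B i j, ∀ y ∈ B i j', T.adj x y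
  out_degree : ∀ i i', i < i' → i' < K → ∀ j < p, ∀ j' < p, ∀ x ∈ B i j,
    M * #{y ∈ B i' j' | ¬ T.adj x y} ≤ #(B i' j')
  in_degree : ∀ i i', i < i' → i' < K → ∀ j < p, ∀ j' < p, ∀ y ∈ B i' j',
    M * #{x ∈ B i j | ¬ T.adj x y} ≤ #(B i j)

theorem exists_isBlockFamily (H : Tournament h) (K p M : ℕ) : ∃ C : ℕ,
    ∀ {N : ℕ} (T : Tournament N) (s : Finset (Fin N)), T.IsRich s C → ¬ T.Contains H →
      ∃ B, T.IsBlockFamily s K p M C B := by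
  rcases Nat.eq_zero_or_pos p with rfl | hp
  · exact ⟨0, fun {N} T s _ _ => ⟨fun _ _ => ∅, by constructor <;> simp⟩⟩
  obtain ⟨C, hC⟩ := exists_block_sequence H K (2 * K * (4 * p * M)) 1
  refine ⟨C * (4 * p) + 1, fun {N} T s hs hT => ?_⟩
  have hCC : C ≤ C * (4 * p) + 1 :=
    (Nat.le_mul_of_pos_right C (by positivity : 0 < 4 * p)).trans (Nat.le_succ _)
  obtain ⟨S, hS, hSp⟩ := hC T s (hs.mono hCC) hT s subset_rfl (by simp)
  let r (i j : ℕ) (a y : Fin N) : Prop := if i < j then ¬ T.adj a y else ¬ T.adj y a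
  have hhalf : ∀ i, ∃ A ⊆ S i, i < K → #(S i) ≤ 2 * #A ∧
      ∀ a ∈ A, ∀ j ∈ (range K).erase i, 4 * p * M * #{y ∈ S j | r i j a y} ≤ #(S j) := by
    intro i
    by_cases hi : i < K
    · obtain ⟨A, hA⟩ := exists_half_forall_degree_le (A := S i) (J := (range K).erase i) (Y := S)
        (r := r i) (K := K) (M := 4 * p * M)
        ((card_le_card (erase_subset _ _)).trans (by simp)) (fun j hj => by
          rw [mem_erase, mem_range] at hj
          rcases lt_or_gt_of_ne hj.1 with hlt | hlt
          · have h1 := (hSp j i hlt hi).2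
            simp only [r, hlt.not_gt, if_false]
            rwa [nonArcs_comm, mul_comm #(S j)] at h1
          · simp only [r, hlt, if_true]
            exact (hSp i j hlt hj.2).2)
      exact ⟨A, hA.1, fun _ => hA.2⟩
    · exact ⟨∅, empty_subset _, fun h => (hi h).elim⟩
  choose A hAS hA using hhalf
  have hchunk : ∀ i, ∃ P : ℕ → Finset (Fin N), i < K →
      (∀ j < p, P j ⊆ A i ∧ #(A i) ≤ 2 * p * #(P j)) ∧
      (i % 2 = 0 → ∀ j j', j < j' → ∀ x ∈ P j, ∀ y ∈ P j', T.adj x y) := by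
    intro i
    by_cases hi : i < K
    · rcases Nat.mod_two_eq_zero_or_one i with hi2 | hi2
      · have hpA : p ≤ #(A i) := by
          have h1 := ((hS i hi).2.trans hi2).2
          have h2 := hs.le_trSizeOn
          have h3 : C * #(S i) ≤ C * (2 * #(A i)) := Nat.mul_le_mul_left _ (hA i hi).1
          by_contra! hlt
          have h4 : C * (2 * #(A i)) ≤ C * (2 * p) := Nat.mul_le_mul_left _ (by omega)
          have h5 : C * (4 * p) = C * (2 * p) + C * (2 * p) := by ring
          omega
        obtain ⟨P, hP⟩ := (((hS i hi).2.trans hi2).1.mono (hAS i)).exists_chunks hp hpA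
        exact ⟨P, fun _ => ⟨hP.1, fun _ => hP.2⟩⟩
      · exact ⟨fun _ => A i, fun _ => ⟨fun _ _ =>
          ⟨subset_rfl, Nat.le_mul_of_pos_left _ (by positivity)⟩, fun h => by omega⟩⟩
    · exact ⟨fun _ => ∅, fun h => (hi h).elim⟩
  choose B hB using hchunk
  have hBS : ∀ i < K, ∀ j < p, B i j ⊆ S i ∧ #(S i) ≤ 4 * p * #(B i j) := by
    intro i hi j hj
    obtain ⟨h1, h2⟩ := (hB i hi).1 j hj
    refine ⟨h1.trans (hAS i), ?_⟩
    have h3 := (hA i hi).1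
    calc #(S i) ≤ 2 * (2 * p * #(B i j)) := h3.trans (Nat.mul_le_mul_left _ h2)
      _ = _ := by ring
  have hdeg : ∀ i < K, ∀ i' < K, i' ≠ i → ∀ j < p, ∀ j' < p, ∀ x ∈ B i j,
      M * #{y ∈ B i' j' | r i i' x y} ≤ #(B i' j') := by
    intro i hi i' hi' hii j hj j' hj' x hx
    have h1 := (hA i hi).2 x (((hB i hi).1 j hj).1 hx) i'
      (mem_erase.2 ⟨hii, mem_range.2 hi'⟩)
    have h2 : #{y ∈ B i' j' | r i i' x y} ≤ #{y ∈ S i' | r i i' x y} :=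
      card_le_card (filter_subset_filter _ (hBS i' hi' j' hj').1)
    have h3 := (hBS i' hi' j' hj').2
    refine Nat.le_of_mul_le_mul_left ?_ (by positivity : 0 < 4 * p)
    calc 4 * p * (M * #{y ∈ B i' j' | r i i' x y})
        = 4 * p * M * #{y ∈ B i' j' | r i i' x y} := by ring
      _ ≤ 4 * p * M * #{y ∈ S i' | r i i' x y} := Nat.mul_le_mul_left _ h2
      _ ≤ #(S i') := h1
      _ ≤ _ := h3
  refine ⟨B, fun i hi j hj => (hS i hi).2.mono (hBS i hi j hj).1 (hBS i hi j hj).2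
    (Nat.le_succ _), ?_, fun i hi hi2 j j' hjj _ => (hB i hi).2 hi2 j j' hjj, ?_, ?_⟩
  · intro i hi i' hi' hii j hj j' hj'
    rcases lt_or_gt_of_ne hii with hlt | hlt
    · exact (hSp i i' hlt hi').1.mono (hBS i hi j hj).1 (hBS i' hi' j' hj').1
    · exact ((hSp i' i hlt hi).1.mono (hBS i' hi' j' hj').1 (hBS i hi j hj).1).symm
  · intro i i' hii hi' j hj j' hj' x hx
    have := hdeg i (hii.trans hi') i' hi' hii.ne' j hj j' hj' x hx
    simpa only [r, hii, if_true] using this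
  · intro i i' hii hi' j hj j' hj' y hy
    have := hdeg i' hi' i (hii.trans hi') hii.ne j' hj' j hj y hy
    simpa only [r, hii.not_gt, if_false] using this

/-- The arc between `x` and `y` in `T` has the orientation of the arc between `u` and `v` in
`H`. -/
def Realizes (T : Tournament N) (H : Tournament h) (u v : Fin h) (x y : Fin N) : Prop :=
  (H.adj u v → T.adj x y) ∧ (H.adj v u → T.adj y x)

theorem Realizes.symm {T : Tournament N} {H : Tournament h} {u v : Fin h} {x y : Fin N}
    (hr : T.Realizes H u v x y) : T.Realizes H v u y x := ⟨hr.2, hr.1⟩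

/-- If the sets `B v` are pairwise almost complete in the direction prescribed by `H`, except
within the disjoint parts `P i`, and every part embeds into all choices of half-sized subsets of
the corresponding sets `B v`, then `H` embeds into `T`. -/
theorem contains_of_parts {T : Tournament N} {H : Tournament h} {ι : Type*}
    {P : ι → Finset (Fin h)} {B : Fin h → Finset (Fin N)}
    (hP : ∀ i j, i ≠ j → Disjoint (P i) (P j)) (hne : ∀ v, (B v).Nonempty)
    (hB : ∀ u v, H.adj u v → (¬ ∃ i, u ∈ P i ∧ v ∈ P i) →
      (∀ x ∈ B u, 2 * h * #{y ∈ B v | ¬ T.adj x y} ≤ #(B v)) ∧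
      ∀ y ∈ B v, 2 * h * #{x ∈ B u | ¬ T.adj x y} ≤ #(B u))
    (hemb : ∀ i, ∀ B' : Fin h → Finset (Fin N), (∀ v, B' v ⊆ B v ∧ #(B v) ≤ 2 * #(B' v)) →
      ∃ f : Fin h → Fin N, (∀ v ∈ P i, f v ∈ B' v) ∧
        ∀ u ∈ P i, ∀ v ∈ P i, H.adj u v → T.adj (f u) (f v)) :
    T.Contains H := by
  let κ (v : Fin h) : ι ⊕ Fin h := if hv : ∃ i, v ∈ P i then Sum.inl hv.choose else Sum.inr v
  have hκl : ∀ v i, κ v = Sum.inl i ↔ v ∈ P i := by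
    intro v i
    by_cases hv : ∃ i, v ∈ P i
    · simp only [κ, hv, dite_true, Sum.inl.injEq]
      refine ⟨fun hi => hi ▸ hv.choose_spec, fun hi => ?_⟩
      by_contra hne
      exact disjoint_left.1 (hP _ _ hne) hv.choose_spec hi
    · simp only [κ, hv, dite_false, reduceCtorEq, false_iff]
      exact fun hi => hv ⟨i, hi⟩
  have hκr : ∀ u v, κ u = Sum.inr v → u = v := by
    intro u v huv
    by_cases hv : ∃ i, u ∈ P i
    · simp [κ, hv] at huv
    · simpa [κ, hv] using huv
  have hκne : ∀ u v, κ u ≠ κ v → ¬ ∃ i, u ∈ P i ∧ v ∈ P i := by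
    rintro u v huv ⟨i, hu, hv⟩
    exact huv (((hκl u i).2 hu).trans ((hκl v i).2 hv).symm)
  have key : ∀ I : Finset (ι ⊕ Fin h), ∃ f : Fin h → Fin N, (∀ v, κ v ∈ I → f v ∈ B v) ∧
      ∀ u v, κ u ∈ I → κ v ∈ I → H.adj u v → T.adj (f u) (f v) := by
    intro I
    induction I using Finset.induction_on with
    | empty =>
      choose f hf using hne
      exact ⟨f, by simp, by simp⟩
    | insert i I hi ih =>
      obtain ⟨f, hf, hadj⟩ := ih
      have hhalf : ∀ v, ∃ B' ⊆ B v, #(B v) ≤ 2 * #B' ∧ ∀ y ∈ B', ∀ u ∈ univ,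
          κ u ∈ I → κ u ≠ κ v → T.Realizes H u v (f u) y := by
        intro v
        refine exists_half_forall (K := h) (by simp) fun u _ D hD hbad => ?_
        rcases D.eq_empty_or_nonempty with rfl | ⟨y₀, hy₀⟩
        · simp
        have h0 := hbad y₀ hy₀
        push Not at h0
        obtain ⟨huI, huv, -⟩ := h0
        have hbad' : ∀ y ∈ D, ¬ T.Realizes H u v (f u) y := fun y hy hr =>
          hbad y hy fun _ _ => hr
        by_cases h1 : H.adj u v
        · refine le_trans (Nat.mul_le_mul_left _ (card_le_card fun y hy => ?_))
            ((hB u v h1 (hκne u v huv)).1 (f u) (hf u huI))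
          rw [mem_filter]
          exact ⟨hD hy, fun hy' => hbad' y hy
            ⟨fun _ => hy', fun h2 => (H.asymm _ _ h1 h2).elim⟩⟩
        · by_cases h2 : H.adj v u
          · refine le_trans (Nat.mul_le_mul_left _ (card_le_card fun y hy => ?_))
              ((hB v u h2 (hκne v u huv.symm)).2 (f u) (hf u huI))
            rw [mem_filter]
            exact ⟨hD hy, fun hy' => hbad' y hy ⟨fun h => (h1 h).elim, fun _ => hy'⟩⟩
          · exact (hbad' y₀ hy₀ ⟨fun h => (h1 h).elim, fun h => (h2 h).elim⟩).elim
      choose B' hB' hcard hgood using hhalf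
      obtain ⟨g, hg, hgadj⟩ : ∃ g : Fin h → Fin N, (∀ v, κ v = i → g v ∈ B' v) ∧
          ∀ u v, κ u = i → κ v = i → H.adj u v → T.adj (g u) (g v) := by
        cases i with
        | inl i =>
          obtain ⟨g, hg, hadj⟩ := hemb i B' fun v => ⟨hB' v, hcard v⟩
          exact ⟨g, fun v hv => hg v ((hκl v i).1 hv), fun u v hu hv =>
            hadj u ((hκl u i).1 hu) v ((hκl v i).1 hv)⟩
        | inr w =>
          have : ∀ v, ∃ y, y ∈ B' v := fun v => card_pos.1 (by
            have := card_pos.2 (hne v)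
            have := hcard v
            omega)
          choose g hg using this
          refine ⟨g, fun v _ => hg v, fun u v hu hv huv => ?_⟩
          rw [hκr u w hu, hκr v w hv] at huv
          exact (H.adj_irrefl _ huv).elim
      refine ⟨fun v => if κ v = i then g v else f v, fun v hv => ?_, fun u v hu hv huv => ?_⟩
      · dsimp only
        split_ifs with hvi
        · exact hB' v (hg v hvi)
        · exact hf v ((mem_insert.1 hv).resolve_left hvi)
      · dsimp only
        have hI : ∀ w, κ w ∈ insert i I → κ w ≠ i → κ w ∈ I := fun w hw hwi =>
          (mem_insert.1 hw).resolve_left hwi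
        split_ifs with hui hvi hvi
        · exact hgadj u v hui hvi huv
        · exact (hgood u (g u) (hg u hui) v (mem_univ _) (hI v hv hvi)
            (by rw [hui]; exact hvi)).2 huv
        · exact (hgood v (g v) (hg v hvi) u (mem_univ _) (hI u hu hui)
            (by rw [hvi]; exact hui)).1 huv
        · exact hadj u v (hI u hu hui) (hI v hv hvi) huv
  obtain ⟨f, -, hf⟩ := key (univ.image κ)
  exact contains_of_adj f fun u v =>
    hf u v (mem_image_of_mem _ (mem_univ _)) (mem_image_of_mem _ (mem_univ _))

/-- At least half of the vertices of a linear-sized set can serve as images of `c` having, in each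
of the transitive sets assigned to the vertices of `L`, a neighbor of the required kind. -/
theorem IsRich.exists_half_realizes {T : Tournament N} {s : Finset (Fin N)} {C₀ C : ℕ}
    (hs : T.IsRich s C₀) (H : Tournament h) {c : Fin h} {L : Finset (Fin h)}
    (hC : 2 * h * C ≤ C₀) (hcL : c ∉ L) {X : Finset (Fin N)} (hXs : X ⊆ s)
    (hX : #s ≤ C * #X) {Y : Fin h → Finset (Fin N)}
    (hY : ∀ u ∈ L, Y u ⊆ s ∧ T.IsTransOn (Y u) ∧ T.trSizeOn s ≤ C * #(Y u))
    (hXY : ∀ u ∈ L, Disjoint X (Y u)) :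
    ∃ X₀ ⊆ X, #X ≤ 2 * #X₀ ∧ ∀ x ∈ X₀, ∀ u ∈ L, ∃ y ∈ Y u, T.Realizes H c u x y := by
  refine exists_half_forall (K := h) ((card_le_univ L).trans (by simp)) fun u hu D hD hbad => ?_
  by_contra! hlt
  have h1h : 0 < h := c.pos
  have hDc : #s ≤ C₀ * #D := calc
    #s ≤ C * #X := hX
    _ ≤ C * (2 * h * #D) := Nat.mul_le_mul_left _ hlt.le
    _ = 2 * h * C * #D := by ring
    _ ≤ C₀ * #D := Nat.mul_le_mul_right _ hC
  have hCC : C ≤ C₀ := (Nat.le_mul_of_pos_left C (by omega)).trans hC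
  obtain ⟨⟨x, hx, y, hy, hxy⟩, x', hx', y', hy', hxy'⟩ :=
    hs.not_complete D (hD.trans hXs) (Y u) (hY u hu).1 hDc (hY u hu).2.1
      ((hY u hu).2.2.trans (Nat.mul_le_mul_right _ hCC))
  have hne : ∀ x ∈ D, ∀ y ∈ Y u, x ≠ y := fun x hx y hy hxy =>
    disjoint_left.1 (hXY u hu) (hD hx) (hxy ▸ hy)
  have hcu : c ≠ u := fun h => hcL (h ▸ hu)
  rcases H.total c u hcu with h1 | h1
  · exact hbad x' hx' ⟨y', hy', fun _ => T.adj_of_not_adj (hne _ hx' _ hy').symm hxy',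
      fun h2 => (H.asymm _ _ h1 h2).elim⟩
  · exact hbad x hx ⟨y, hy, fun h2 => (H.asymm _ _ h1 h2).elim,
      fun _ => T.adj_of_not_adj (hne _ hx _ hy) hxy⟩

/-- Embedding a star with center `c` and leaves `L`. -/
theorem IsRich.exists_star_embedding {T : Tournament N} {s : Finset (Fin N)} {C₀ C : ℕ}
    (hs : T.IsRich s C₀) (H : Tournament h) {c : Fin h} {L : Finset (Fin h)}
    (hC : 2 * h * C ≤ C₀) (hcL : c ∉ L) {B : Fin h → Finset (Fin N)} (hc : B c ⊆ s)
    (hcc : #s ≤ C * #(B c)) (hcne : (B c).Nonempty)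
    (hL : ∀ u ∈ L, B u ⊆ s ∧ T.IsTransOn (B u) ∧ T.trSizeOn s ≤ C * #(B u))
    (hd : ∀ u ∈ L, Disjoint (B c) (B u))
    (hLL : ∀ u ∈ L, ∀ v ∈ L, H.adj u v → ∀ x ∈ B c, ∀ y ∈ B u, ∀ z ∈ B v,
      T.Realizes H c u x y → T.Realizes H c v x z → T.adj y z) :
    ∃ f : Fin h → Fin N, (∀ v ∈ insert c L, f v ∈ B v) ∧
      ∀ u ∈ insert c L, ∀ v ∈ insert c L, H.adj u v → T.adj (f u) (f v) := by
  obtain ⟨X, hX, hXc, hXL⟩ := hs.exists_half_realizes H hC hcL hc hcc hL hd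
  obtain ⟨x, hx⟩ : X.Nonempty := card_pos.1 (by have := card_pos.2 hcne; omega)
  have hg : ∀ u, ∃ y, u ∈ L → y ∈ B u ∧ T.Realizes H c u x y := fun u => by
    by_cases hu : u ∈ L
    · obtain ⟨y, hy⟩ := hXL x hx u hu
      exact ⟨y, fun _ => hy⟩
    · exact ⟨x, fun h => (hu h).elim⟩
  choose g hg using hg
  have hne : ∀ u ∈ L, u ≠ c := fun u hu h => hcL (h ▸ hu)
  refine ⟨Function.update g c x, fun v hv => ?_, fun u hu v hv huv => ?_⟩
  · rcases mem_insert.1 hv with rfl | hv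
    · simpa using hX hx
    · simpa [hne v hv] using (hg v hv).1
  · rcases mem_insert.1 hu with rfl | hu' <;> rcases mem_insert.1 hv with rfl | hv'
    · exact (H.adj_irrefl _ huv).elim
    · simpa [hne v hv'] using (hg v hv').2.1 huv
    · simpa [hne u hu'] using (hg u hu').2.2 huv
    · simpa [hne u hu', hne v hv'] using
        hLL u hu' v hv' huv x (hX hx) _ (hg u hu').1 _ (hg v hv').1 (hg u hu').2 (hg v hv').2

/-- Embedding a super 2-nebula with centers `c₁, c₂` and leaves `L₁, L₂`. -/
theorem IsRich.exists_twoStar_embedding {T : Tournament N} {s : Finset (Fin N)} {C₀ C : ℕ}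
    (hs : T.IsRich s C₀) (H : Tournament h) {c₁ c₂ : Fin h} {L₁ L₂ : Finset (Fin h)}
    (hC : 2 * h * C ≤ C₀) (h2C : 2 ≤ C₀) (hc : c₁ ≠ c₂) (h₁ : c₁ ∉ L₁ ∪ L₂)
    (h₂ : c₂ ∉ L₁ ∪ L₂) {B : Fin h → Finset (Fin N)}
    (hcs : ∀ c ∈ ({c₁, c₂} : Finset (Fin h)), B c ⊆ s ∧ #s ≤ C * #(B c))
    (hL : ∀ u ∈ L₁ ∪ L₂, B u ⊆ s ∧ T.IsTransOn (B u) ∧ T.trSizeOn s ≤ C * #(B u))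
    (hd : ∀ c ∈ ({c₁, c₂} : Finset (Fin h)), ∀ u ∈ L₁ ∪ L₂, Disjoint (B c) (B u))
    (hdc : Disjoint (B c₁) (B c₂))
    (hLL : ∀ u ∈ L₁ ∪ L₂, ∀ v ∈ L₁ ∪ L₂, H.adj u v → ∀ y ∈ B u, ∀ z ∈ B v, T.adj y z)
    (h₁₂ : ∀ u ∈ L₁, ∀ x₁ ∈ B c₁, ∀ x₂ ∈ B c₂, ∀ y ∈ B u, T.Realizes H c₁ c₂ x₁ x₂ →
      T.Realizes H c₁ u x₁ y → T.Realizes H c₂ u x₂ y)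
    (h₂₁ : ∀ u ∈ L₂, ∀ x₁ ∈ B c₁, ∀ x₂ ∈ B c₂, ∀ y ∈ B u, T.Realizes H c₁ c₂ x₁ x₂ →
      T.Realizes H c₂ u x₂ y → T.Realizes H c₁ u x₁ y) :
    ∃ f : Fin h → Fin N, (∀ v ∈ insert c₁ (insert c₂ (L₁ ∪ L₂)), f v ∈ B v) ∧
      ∀ u ∈ insert c₁ (insert c₂ (L₁ ∪ L₂)), ∀ v ∈ insert c₁ (insert c₂ (L₁ ∪ L₂)),
        H.adj u v → T.adj (f u) (f v) := by
  have m₁ : c₁ ∈ ({c₁, c₂} : Finset (Fin h)) := by simp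
  have m₂ : c₂ ∈ ({c₁, c₂} : Finset (Fin h)) := by simp
  have i₁ : ∀ u ∈ L₁, u ∈ L₁ ∪ L₂ := fun u hu => mem_union_left _ hu
  have i₂ : ∀ u ∈ L₂, u ∈ L₁ ∪ L₂ := fun u hu => mem_union_right _ hu
  obtain ⟨X₁, hX₁, hX₁c, hX₁L⟩ := hs.exists_half_realizes H (L := L₁) hC
    (fun h => h₁ (i₁ _ h)) (hcs c₁ m₁).1 (hcs c₁ m₁).2 (fun u hu => hL u (i₁ u hu))
    (fun u hu => hd c₁ m₁ u (i₁ u hu))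
  obtain ⟨X₂, hX₂, hX₂c, hX₂L⟩ := hs.exists_half_realizes H (L := L₂) hC
    (fun h => h₂ (i₂ _ h)) (hcs c₂ m₂).1 (hcs c₂ m₂).2 (fun u hu => hL u (i₂ u hu))
    (fun u hu => hd c₂ m₂ u (i₂ u hu))
  have hlin : ∀ X Z : Finset (Fin N), #s ≤ C * #X → #X ≤ 2 * #Z → #s ≤ C₀ * #Z :=
    fun X Z hX hZ => calc
      #s ≤ C * (2 * #Z) := hX.trans (Nat.mul_le_mul_left _ hZ)
      _ = 2 * 1 * C * #Z := by ring
      _ ≤ 2 * h * C * #Z := by gcongr; exact c₁.pos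
      _ ≤ C₀ * #Z := Nat.mul_le_mul_right _ hC
  obtain ⟨R, hR, hRt, hRc⟩ := hs.exists_trans X₂ (hX₂.trans (hcs c₂ m₂).1)
    (hlin _ _ (hcs c₂ m₂).2 hX₂c)
  obtain ⟨x₁, hx₁, x₂, hx₂, hx⟩ : ∃ x₁ ∈ X₁, ∃ x₂ ∈ R, T.Realizes H c₁ c₂ x₁ x₂ := by
    obtain ⟨⟨x, hx, y, hy, hxy⟩, x', hx', y', hy', hxy'⟩ :=
      hs.not_complete X₁ (hX₁.trans (hcs c₁ m₁).1) R (hR.trans (hX₂.trans (hcs c₂ m₂).1))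
        (hlin _ _ (hcs c₁ m₁).2 hX₁c) hRt (hRc.trans (Nat.mul_le_mul_right _ h2C))
    have hne : ∀ x ∈ X₁, ∀ y ∈ R, x ≠ y := fun x hx y hy hxy =>
      disjoint_left.1 hdc (hX₁ hx) (hxy ▸ hX₂ (hR hy))
    rcases H.total c₁ c₂ hc with h1 | h1
    · exact ⟨x', hx', y', hy', fun _ => T.adj_of_not_adj (hne _ hx' _ hy').symm hxy',
        fun h2 => (H.asymm _ _ h1 h2).elim⟩
    · exact ⟨x, hx, y, hy, fun h2 => (H.asymm _ _ h1 h2).elim,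
        fun _ => T.adj_of_not_adj (hne _ hx _ hy) hxy⟩
  have hx₁B := hX₁ hx₁
  have hx₂B := hX₂ (hR hx₂)
  have hg : ∀ u, ∃ y, u ∈ L₁ ∪ L₂ → y ∈ B u ∧ T.Realizes H c₁ u x₁ y ∧
      T.Realizes H c₂ u x₂ y := fun u => by
    by_cases hu₁ : u ∈ L₁
    · obtain ⟨y, hy, hr⟩ := hX₁L x₁ hx₁ u hu₁
      exact ⟨y, fun _ => ⟨hy, hr, h₁₂ u hu₁ x₁ hx₁B x₂ hx₂B y hy hx hr⟩⟩
    · by_cases hu₂ : u ∈ L₂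
      · obtain ⟨y, hy, hr⟩ := hX₂L x₂ (hR hx₂) u hu₂
        exact ⟨y, fun _ => ⟨hy, h₂₁ u hu₂ x₁ hx₁B x₂ hx₂B y hy hx hr, hr⟩⟩
      · exact ⟨x₁, fun h => ((mem_union.1 h).elim hu₁ hu₂).elim⟩
  choose g hg using hg
  have hne₁ : ∀ u ∈ L₁ ∪ L₂, u ≠ c₁ := fun u hu h => h₁ (h ▸ hu)
  have hne₂ : ∀ u ∈ L₁ ∪ L₂, u ≠ c₂ := fun u hu h => h₂ (h ▸ hu)
  let f : Fin h → Fin N := Function.update (Function.update g c₁ x₁) c₂ x₂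
  have hf₁ : f c₁ = x₁ := by simp [f, hc]
  have hf₂ : f c₂ = x₂ := by simp [f]
  have hfL : ∀ u ∈ L₁ ∪ L₂, f u = g u := fun u hu => by simp [f, hne₁ u hu, hne₂ u hu]
  refine ⟨f, fun v hv => ?_, fun u hu v hv huv => ?_⟩
  · rcases mem_insert.1 hv with rfl | hv
    · exact hf₁ ▸ hx₁B
    rcases mem_insert.1 hv with rfl | hv
    · exact hf₂ ▸ hx₂B
    · exact hfL v hv ▸ (hg v hv).1
  · rcases mem_insert.1 hu with hu | hu' <;> rcases mem_insert.1 hv with hv | hv'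
    · exact (H.adj_irrefl c₁ (by rwa [hu, hv] at huv)).elim
    · rcases mem_insert.1 hv' with hv' | hv''
      · rw [hu, hv', hf₁, hf₂]
        exact hx.1 (by rwa [hu, hv'] at huv)
      · rw [hu, hf₁, hfL v hv'']
        exact (hg v hv'').2.1.1 (hu ▸ huv)
    · rcases mem_insert.1 hu' with hu' | hu''
      · rw [hv, hu', hf₁, hf₂]
        exact hx.2 (by rwa [hv, hu'] at huv)
      · rw [hv, hf₁, hfL u hu'']
        exact (hg u hu'').2.1.2 (hv ▸ huv)
    · rcases mem_insert.1 hu' with hu' | hu'' <;> rcases mem_insert.1 hv' with hv' | hv''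
      · exact (H.adj_irrefl c₂ (by rwa [hu', hv'] at huv)).elim
      · rw [hu', hf₂, hfL v hv'']
        exact (hg v hv'').2.2.1 (hu' ▸ huv)
      · rw [hv', hf₂, hfL u hu'']
        exact (hg u hu'').2.2.2 (hv' ▸ huv)
      · rw [hfL u hu'', hfL v hv'']
        exact hLL u hu'' v hv'' huv _ (hg u hu'').1 _ (hg v hv'').1

/-- The arc between `u` and `v` is a backward arc under `θ`. -/
def BackPair (T : Tournament n) (θ : Equiv.Perm (Fin n)) (u v : Fin n) : Prop :=
  T.Backward θ u v ∨ T.Backward θ v u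

theorem pos_injective (θ : Equiv.Perm (Fin n)) : Function.Injective (pos θ) :=
  θ.symm.injective

theorem pos_lt_of_not_backPair {T : Tournament n} {θ : Equiv.Perm (Fin n)} {u v : Fin n}
    (h : ¬ T.BackPair θ u v) (huv : T.adj u v) : pos θ u < pos θ v := by
  rcases lt_trichotomy (pos θ u) (pos θ v) with hlt | heq | hlt
  · exact hlt
  · exact (T.adj_irrefl v ((pos_injective θ heq) ▸ huv)).elim
  · exact (h (Or.inl ⟨huv, hlt⟩)).elim

theorem IsStarAt.spec {T : Tournament n} {θ : Equiv.Perm (Fin n)} {S : Finset (Fin n)}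
    {c : Fin n} (hS : T.IsStarAt θ S c) : c ∈ S ∧ (∀ u ∈ S.erase c, T.BackPair θ c u) ∧
      ∀ u ∈ S.erase c, ∀ v ∈ S.erase c, ¬ T.BackPair θ u v := by
  have key : c ∈ S ∧ (∀ u ∈ S.erase c, T.BackPair θ c u) ∧
      ∀ u ∈ S, ∀ v ∈ S, T.Backward θ u v → u = c ∨ v = c := by
    rcases hS with ⟨hc, -, h1, h2⟩ | ⟨hc, -, h1, h2⟩ | ⟨hc, -, -, h1, h2⟩
    · exact ⟨hc, fun u hu => Or.inr ⟨(h1 u hu).2, (h1 u hu).1⟩,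
        fun u hu v hv huv => Or.inr (h2 u hu v hv huv)⟩
    · exact ⟨hc, fun u hu => Or.inl ⟨(h1 u hu).2, (h1 u hu).1⟩,
        fun u hu v hv huv => Or.inl (h2 u hu v hv huv)⟩
    · refine ⟨hc, fun u hu => ?_, h2⟩
      rcases lt_trichotomy (pos θ u) (pos θ c) with hlt | heq | hlt
      · exact Or.inl ⟨(h1 u hu).1 hlt, hlt⟩
      · exact ((mem_erase.1 hu).1 (pos_injective θ heq)).elim
      · exact Or.inr ⟨(h1 u hu).2 hlt, hlt⟩
  refine ⟨key.1, key.2.1, fun u hu v hv huv => ?_⟩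
  rw [mem_erase] at hu hv
  rcases huv with huv | huv
  · exact (key.2.2 u hu.2 v hv.2 huv).elim hu.1 hv.1
  · exact (key.2.2 v hv.2 u hu.2 huv).elim hv.1 hu.1

/-- The properties of super 2-nebulas that do not depend on the kind. -/
theorem IsSuper2NebulaAt.spec {T : Tournament n} {θ : Equiv.Perm (Fin n)} {S : Finset (Fin n)}
    {c₁ c₂ : Fin n} {L₁ L₂ : Finset (Fin n)} {kd : NebKind}
    (hS : T.IsSuper2NebulaAt θ S c₁ c₂ L₁ L₂ kd) :
    Super2NebCommon θ S c₁ c₂ L₁ L₂ ∧ T.BackPair θ c₁ c₂ ∧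
    (∀ u ∈ L₁, T.BackPair θ c₁ u ∧ ¬ T.BackPair θ c₂ u) ∧
    (∀ u ∈ L₂, T.BackPair θ c₂ u ∧ ¬ T.BackPair θ c₁ u) ∧
    (∀ u ∈ L₁ ∪ L₂, ∀ v ∈ L₁ ∪ L₂, ¬ T.BackPair θ u v) ∧
    ¬ BetweenSet θ (L₁ ∪ L₂) c₁ ∧ ¬ BetweenSet θ (L₁ ∪ L₂) c₂ := by
  have key : Super2NebCommon θ S c₁ c₂ L₁ L₂ ∧ T.BackPair θ c₁ c₂ ∧
      (∀ u ∈ L₁, T.BackPair θ c₁ u) ∧ (∀ u ∈ L₂, T.BackPair θ c₂ u) ∧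
      (∀ u ∈ S, ∀ v ∈ S, T.Backward θ u v → (u ∈ L₁ ∧ v = c₁) ∨ (u = c₁ ∧ v ∈ L₁) ∨
        (u ∈ L₂ ∧ v = c₂) ∨ (u = c₂ ∧ v ∈ L₂) ∨ (u = c₂ ∧ v = c₁)) ∧
      ¬ BetweenSet θ (L₁ ∪ L₂) c₁ ∧ ¬ BetweenSet θ (L₁ ∪ L₂) c₂ := by
    cases kd with
    | left =>
      obtain ⟨hc, hL, h1, h2, h3, h4⟩ := hS
      refine ⟨hc, Or.inr ⟨h3, hc.2.2.2.2.2.2.2⟩,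
        fun u hu => Or.inl ⟨h1 u hu, hL u (mem_union_left _ hu)⟩,
        fun u hu => Or.inl ⟨h2 u hu, (hL u (mem_union_right _ hu)).trans hc.2.2.2.2.2.2.2⟩,
        fun u hu v hv huv => ?_, ?_, ?_⟩
      · have := h4 u hu v hv huv
        tauto
      · rintro ⟨u, -, w, hw, -, hlt⟩
        exact hlt.not_gt (hL w hw)
      · rintro ⟨u, -, w, hw, -, hlt⟩
        exact hlt.not_gt ((hL w hw).trans hc.2.2.2.2.2.2.2)
    | middle =>
      obtain ⟨hc, hL, h1, h2, h3, h4⟩ := hS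
      refine ⟨hc, Or.inr ⟨h3, hc.2.2.2.2.2.2.2⟩,
        fun u hu => Or.inr ⟨h1 u hu, (hL u (mem_union_left _ hu)).1⟩,
        fun u hu => Or.inl ⟨h2 u hu, (hL u (mem_union_right _ hu)).2⟩,
        fun u hu v hv huv => ?_, ?_, ?_⟩
      · have := h4 u hu v hv huv
        tauto
      · rintro ⟨u, hu, w, -, hlt, -⟩
        exact hlt.not_gt (hL u hu).1
      · rintro ⟨u, -, w, hw, -, hlt⟩
        exact hlt.not_gt (hL w hw).2
    | right =>
      obtain ⟨hc, hL, h1, h2, h3, h4⟩ := hS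
      refine ⟨hc, Or.inr ⟨h3, hc.2.2.2.2.2.2.2⟩,
        fun u hu => Or.inr ⟨h1 u hu, hc.2.2.2.2.2.2.2.trans (hL u (mem_union_left _ hu))⟩,
        fun u hu => Or.inr ⟨h2 u hu, hL u (mem_union_right _ hu)⟩,
        fun u hu v hv huv => ?_, ?_, ?_⟩
      · have := h4 u hu v hv huv
        tauto
      · rintro ⟨u, hu, w, -, hlt, -⟩
        exact hlt.not_gt (hc.2.2.2.2.2.2.2.trans (hL u hu))
      · rintro ⟨u, hu, w, -, hlt, -⟩
        exact hlt.not_gt (hL u hu)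
  obtain ⟨hc, h12, h1, h2, hb, hb1, hb2⟩ := key
  obtain ⟨-, -, hd, hc1, hc2, hne, hSeq, -⟩ := id hc
  rw [mem_union, not_or] at hc1 hc2
  have hd1 : ∀ u ∈ L₁, u ∉ L₂ := fun u h h' => disjoint_left.1 hd h h'
  have hS1 : c₁ ∈ S := by simp [hSeq]
  have hS2 : c₂ ∈ S := by simp [hSeq]
  have hSL : ∀ u ∈ L₁ ∪ L₂, u ∈ S ∧ u ≠ c₁ ∧ u ≠ c₂ := by
    intro u hu
    refine ⟨by simp only [hSeq, mem_insert]; tauto, ?_, ?_⟩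
    · rintro rfl
      exact (mem_union.1 hu).elim hc1.1 hc1.2
    · rintro rfl
      exact (mem_union.1 hu).elim hc2.1 hc2.2
  have hnb : ∀ u ∈ S, ∀ v ∈ S, ¬ ((u ∈ L₁ ∧ v = c₁) ∨ (u = c₁ ∧ v ∈ L₁) ∨
      (u ∈ L₂ ∧ v = c₂) ∨ (u = c₂ ∧ v ∈ L₂) ∨ (u = c₂ ∧ v = c₁)) → ¬ T.Backward θ u v :=
    fun u hu v hv h h' => h (hb u hu v hv h')
  refine ⟨hc, h12, fun u hu => ⟨h1 u hu, ?_⟩, fun u hu => ⟨h2 u hu, ?_⟩,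
    fun u hu v hv => ?_, hb1, hb2⟩
  · have hu' := hSL u (mem_union_left _ hu)
    have := hd1 u hu
    rintro (h | h)
    · exact hnb _ hS2 _ hu'.1 (by tauto) h
    · exact hnb _ hu'.1 _ hS2 (by tauto) h
  · have hu' := hSL u (mem_union_right _ hu)
    have : u ∉ L₁ := fun h => hd1 u h hu
    have hne' := hne.symm
    rintro (h | h)
    · exact hnb _ hS1 _ hu'.1 (by tauto) h
    · exact hnb _ hu'.1 _ hS1 (by tauto) h
  · have hu' := hSL u hu
    have hv' := hSL v hv
    rintro (h | h)
    · exact hnb _ hu'.1 _ hv'.1 (by tauto) h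
    · exact hnb _ hv'.1 _ hu'.1 (by tauto) h

/-- A monotone labelling of the vertices such that the vertices satisfying `sp` receive distinct
odd labels, and the other vertices receive even labels which only depend on the set of vertices
satisfying `sp` that precede them. -/
noncomputable def index (θ : Equiv.Perm (Fin h)) (sp : Fin h → Prop) (v : Fin h) : ℕ :=
  2 * #{u | sp u ∧ pos θ u < pos θ v} + if sp v then 1 else 0

section Index

variable {θ : Equiv.Perm (Fin h)} {sp : Fin h → Prop} {u v : Fin h}

theorem index_mod_two_of (hv : sp v) : index θ sp v % 2 = 1 := by simp [index, hv, Nat.add_mod]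

theorem index_mod_two_of_not (hv : ¬ sp v) : index θ sp v % 2 = 0 := by simp [index, hv]

theorem index_le (θ : Equiv.Perm (Fin h)) (sp : Fin h → Prop) (v : Fin h) :
    index θ sp v ≤ 2 * h + 1 := by
  have h1 : #{u | sp u ∧ pos θ u < pos θ v} ≤ h := (card_le_univ _).trans (by simp)
  unfold index
  split_ifs <;> omega

theorem index_mono (huv : pos θ u < pos θ v) :
    index θ sp u < index θ sp v ∨ index θ sp u = index θ sp v ∧ ¬ sp u ∧ ¬ sp v := by
  have hsub : univ.filter (fun w => sp w ∧ pos θ w < pos θ u) ⊆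
      univ.filter fun w => sp w ∧ pos θ w < pos θ v := fun w hw => by
    simp only [mem_filter, mem_univ, true_and] at hw ⊢
    exact ⟨hw.1, hw.2.trans huv⟩
  have h1 := card_le_card hsub
  by_cases hu : sp u
  · have h2 : #{w | sp w ∧ pos θ w < pos θ u} < #{w | sp w ∧ pos θ w < pos θ v} :=
      card_lt_card ((ssubset_iff_of_subset hsub).2 ⟨u, by simp [hu, huv], by simp⟩)
    left
    simp only [index, hu, if_true]
    split_ifs <;> omega
  · by_cases hv : sp v
    · left
      simp only [index, hu, hv, if_true, if_false]
      omega
    · simp only [index, hu, hv, if_false, not_false_iff, and_true]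
      omega

theorem index_ne (huv : u ≠ v) (h : sp u ∨ sp v) : index θ sp u ≠ index θ sp v := by
  rcases lt_or_gt_of_ne ((pos_injective θ).ne huv) with hlt | hlt
  · rcases index_mono (sp := sp) hlt with h1 | h1
    · exact h1.ne
    · exact (h.elim h1.2.1 h1.2.2).elim
  · rcases index_mono (sp := sp) hlt with h1 | h1
    · exact h1.ne'
    · exact (h.elim h1.2.2 h1.2.1).elim

theorem index_eq_of_not_between {L : Finset (Fin h)} (hL : ∀ w, sp w → ¬ BetweenSet θ L w)
    (hs : ∀ w ∈ L, ¬ sp w) (hu : u ∈ L) (hv : v ∈ L) : index θ sp u = index θ sp v := by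
  have key : ∀ u ∈ L, ∀ v ∈ L, ∀ w, sp w → pos θ w < pos θ u → pos θ w < pos θ v := by
    intro u hu v hv w hw hwu
    by_contra hwv
    refine hL w hw ⟨v, hv, u, hu, lt_of_le_of_ne (not_lt.1 hwv) fun heq => ?_, hwu⟩
    exact hs v hv (pos_injective θ heq ▸ hw)
  have : univ.filter (fun w => sp w ∧ pos θ w < pos θ u) =
      univ.filter fun w => sp w ∧ pos θ w < pos θ v := by
    ext w
    simp only [mem_filter, mem_univ, true_and]
    exact ⟨fun hw => ⟨hw.1, key u hu v hv w hw.1 hw.2⟩,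
      fun hw => ⟨hw.1, key v hv u hu w hw.1 hw.2⟩⟩
  simp only [index, hs u hu, hs v hv, this]

end Index

section BlockFamily

variable {T : Tournament N} {s : Finset (Fin N)} {K p M C : ℕ} {B : ℕ → ℕ → Finset (Fin N)}

theorem IsBlockFamily.degree (hB : T.IsBlockFamily s K p M C B) {i i' j j' : ℕ}
    (hi : i < i' ∨ i = i' ∧ i % 2 = 0 ∧ j < j') (hi' : i' < K) (hj : j < p) (hj' : j' < p) :
    (∀ x ∈ B i j, M * #{y ∈ B i' j' | ¬ T.adj x y} ≤ #(B i' j')) ∧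
    ∀ y ∈ B i' j', M * #{x ∈ B i j | ¬ T.adj x y} ≤ #(B i j) := by
  rcases hi with hi | ⟨rfl, hi, hjj⟩
  · exact ⟨hB.out_degree i i' hi hi' j hj j' hj', hB.in_degree i i' hi hi' j hj j' hj'⟩
  · have hc := hB.chunk i hi' hi j j' hjj hj'
    refine ⟨fun x hx => ?_, fun y hy => ?_⟩
    · rw [filter_eq_empty_iff.2 fun y hy => not_not.2 (hc x hx y hy)]
      simp
    · rw [filter_eq_empty_iff.2 fun x hx => not_not.2 (hc x hx y hy)]
      simp

/-- No three vertices in well-separated blocks are pairwise joined by backward arcs. -/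
def NoBackTriangle (T : Tournament N) (K p D : ℕ) (B : ℕ → ℕ → Finset (Fin N)) : Prop :=
  ∀ i j k, D ≤ i → i + D ≤ j → j + D ≤ k → k + D ≤ K → ∀ a < p, ∀ b < p, ∀ c < p,
    ∀ x ∈ B i a, ∀ y ∈ B j b, ∀ z ∈ B k c, T.adj y x → T.adj z x → ¬ T.adj z y

/-- A labelling of the vertices of a tournament by the indices of a block family that is
compatible with the ordering `θ`. -/
structure IsLabelling (θ : Equiv.Perm (Fin h)) (K : ℕ) (e : Fin h → ℕ) : Prop where
  lt : ∀ v, e v < K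
  mono : ∀ u v, pos θ u < pos θ v → e u < e v ∨ e u = e v ∧ e u % 2 = 0

variable {θ : Equiv.Perm (Fin h)} {e : Fin h → ℕ}

theorem IsLabelling.lt_of_pos_lt (he : IsLabelling θ K e) {u v : Fin h} (hne : e u ≠ e v)
    (huv : pos θ u < pos θ v) : e u < e v :=
  (he.mono u v huv).resolve_right fun h => hne h.1

theorem IsBlockFamily.degree_labelling (hB : T.IsBlockFamily s K p M C B) (hp : h ≤ p)
    (he : IsLabelling θ K e) {u v : Fin h} (huv : pos θ u < pos θ v) :
    (∀ x ∈ B (e u) (pos θ u), M * #{y ∈ B (e v) (pos θ v) | ¬ T.adj x y} ≤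
      #(B (e v) (pos θ v))) ∧
    ∀ y ∈ B (e v) (pos θ v), M * #{x ∈ B (e u) (pos θ u) | ¬ T.adj x y} ≤
      #(B (e u) (pos θ u)) :=
  hB.degree ((he.mono u v huv).imp_right fun h => ⟨h.1, h.2, huv⟩) (he.lt v)
    ((pos θ u).2.trans_le hp) ((pos θ v).2.trans_le hp)

theorem IsBlockFamily.disjoint_labelling (hB : T.IsBlockFamily s K p M C B) (hp : h ≤ p)
    (he : IsLabelling θ K e) {u v : Fin h} (huv : e u ≠ e v) :
    Disjoint (B (e u) (pos θ u)) (B (e v) (pos θ v)) :=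
  hB.disjoint _ (he.lt u) _ (he.lt v) huv _ ((pos θ u).2.trans_le hp) _
    ((pos θ v).2.trans_le hp)

theorem IsBlockFamily.block_labelling (hB : T.IsBlockFamily s K p M C B) (hp : h ≤ p)
    (he : IsLabelling θ K e) (v : Fin h) : T.IsBlock s C (e v) (B (e v) (pos θ v)) :=
  hB.block _ (he.lt v) _ ((pos θ v).2.trans_le hp)

theorem IsBlockFamily.adj_of_eq (hB : T.IsBlockFamily s K p M C B) (hp : h ≤ p)
    (he : IsLabelling θ K e) {u v : Fin h} (huv : pos θ u < pos θ v) (heq : e u = e v)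
    {x y : Fin N} (hx : x ∈ B (e u) (pos θ u)) (hy : y ∈ B (e v) (pos θ v)) : T.adj x y := by
  have h0 := ((he.mono u v huv).resolve_left heq.not_lt).2
  exact hB.chunk _ (he.lt u) h0 _ _ huv ((pos θ v).2.trans_le hp) x hx y (heq ▸ hy)

theorem NoBackTriangle.realizes {H : Tournament h} {D : ℕ} (hD : T.NoBackTriangle K p D B)
    (hB : T.IsBlockFamily s K p M C B) (hp : h ≤ p) (he : IsLabelling θ K e)
    (heD : ∀ u v, e u < e v → e u + D ≤ e v) (he0 : ∀ v, D ≤ e v ∧ e v + D ≤ K)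
    {u v w : Fin h} (huv : e u ≠ e v) (huw : e u ≠ e w) (hvw : e v ≠ e w)
    (buv : H.BackPair θ u v) (buw : H.BackPair θ u w) (bvw : ¬ H.BackPair θ v w)
    {x y z : Fin N} (hx : x ∈ B (e u) (pos θ u)) (hy : y ∈ B (e v) (pos θ v))
    (hz : z ∈ B (e w) (pos θ w)) (rxy : T.Realizes H u v x y) (rxz : T.Realizes H u w x z) :
    T.Realizes H v w y z := by
  have hq : ∀ v, (pos θ v : ℕ) < p := fun v => (pos θ v).2.trans_le hp
  have key : ∀ u v w : Fin h, ∀ x ∈ B (e u) (pos θ u), ∀ y ∈ B (e v) (pos θ v),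
      ∀ z ∈ B (e w) (pos θ w), e u < e v → e v < e w →
      T.adj y x → T.adj z x → T.adj z y → False := fun u v w x hx y hy z hz h1 h2 =>
    hD _ _ _ (he0 u).1 (heD u v h1) (heD v w h2) (he0 w).2 _ (hq u) _ (hq v) _ (hq w)
      x hx y hy z hz
  have hback : ∀ u v, e u ≠ e v → H.BackPair θ u v → ∀ x y, T.Realizes H u v x y →
      e u < e v ∧ T.adj y x ∨ e v < e u ∧ T.adj x y := by
    rintro u v huv (⟨h1, h2⟩ | ⟨h1, h2⟩) x y hr
    · exact Or.inr ⟨he.lt_of_pos_lt huv.symm h2, hr.1 h1⟩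
    · exact Or.inl ⟨he.lt_of_pos_lt huv h2, hr.2 h1⟩
  have hyz : y ≠ z := fun h =>
    disjoint_left.1 (hB.disjoint_labelling hp he hvw) hy (h ▸ hz)
  have h1 := hback u v huv buv x y rxy
  have h2 := hback u w huw buw x z rxz
  refine ⟨fun hH => ?_, fun hH => ?_⟩ <;> refine T.adj_of_not_adj (by tauto) fun h3 => ?_
  · have h4 := he.lt_of_pos_lt hvw (pos_lt_of_not_backPair bvw hH)
    rcases h1 with h1 | h1 <;> rcases h2 with h2 | h2
    · exact key u v w x hx y hy z hz h1.1 h4 h1.2 h2.2 h3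
    · omega
    · exact key v u w y hy x hx z hz h1.1 h2.1 h1.2 h3 h2.2
    · exact key v w u y hy z hz x hx h4 h2.1 h3 h1.2 h2.2
  · have h4 := he.lt_of_pos_lt hvw.symm (pos_lt_of_not_backPair (fun h => bvw h.symm) hH)
    rcases h1 with h1 | h1 <;> rcases h2 with h2 | h2
    · exact key u w v x hx z hz y hy h2.1 h4 h2.2 h1.2 h3
    · exact key w u v z hz x hx y hy h2.1 h1.1 h2.2 h3 h1.2
    · omega
    · exact key w v u z hz y hy x hx h4 h1.1 h3 h2.2 h1.2

end BlockFamily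

/-- A rich set with a block family without well-separated backward triangles contains every super
nebula. -/
theorem IsBlockFamily.contains_superNebula {T : Tournament N} {s : Finset (Fin N)}
    {K p M C C₀ D : ℕ} {B : ℕ → ℕ → Finset (Fin N)} (hs : T.IsRich s C₀)
    (hB : T.IsBlockFamily s K p M C B) (hD : T.NoBackTriangle K p D B) (hD2 : D % 2 = 0)
    (H : Tournament h) (hH : H.IsSuperNebula) (hp : h ≤ p) (hM : 2 * h ≤ M)
    (hK : (D + 1) * (2 * h + 1) + 2 * D + 1 ≤ K) (hC : 2 * h * (2 * C) ≤ C₀) (hC₀ : 2 ≤ C₀) :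
    T.Contains H := by
  obtain ⟨θ, m, l, Q, ctr, Sig, c₁, c₂, L₁, L₂, kd, hQ, hSig, dQ, dSig, dQS, hback, hctr, hcen⟩ :=
    hH
  have hQ' := fun i => (hQ i).spec
  have hSig' := fun i => (hSig i).spec
  let sp (v : Fin h) : Prop := (∃ i, v = ctr i) ∨ ∃ j, v = c₁ j ∨ v = c₂ j
  let e (v : Fin h) : ℕ := (D + 1) * index θ sp v + D
  have heD : ∀ u v, index θ sp u < index θ sp v → e u + D < e v := fun u v huv => by
    have : (D + 1) * (index θ sp u + 1) ≤ (D + 1) * index θ sp v := Nat.mul_le_mul_left _ huv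
    simp only [e]
    rw [Nat.mul_succ] at this
    omega
  have heD' : ∀ u v, e u < e v → e u + D ≤ e v := fun u v huv => by
    refine (heD u v ?_).le
    by_contra! hle
    have := Nat.mul_le_mul_left (D + 1) hle
    simp only [e] at huv
    omega
  have heK : ∀ v, D ≤ e v ∧ e v + D < K := fun v => by
    have := Nat.mul_le_mul_left (D + 1) (index_le θ sp v)
    simp only [e]
    omega
  have he2 : ∀ v, e v % 2 = index θ sp v % 2 := fun v => by
    simp [e, Nat.add_mod, Nat.mul_mod, hD2]
  have hel : IsLabelling θ K e := ⟨fun v => by have := heK v; omega, fun u v huv => by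
    rcases index_mono (sp := sp) huv with h1 | h1
    · exact Or.inl (by have := heD u v h1; omega)
    · exact Or.inr ⟨by simp only [e, h1.1], by rw [he2, index_mod_two_of_not h1.2.1]⟩⟩
  have hene : ∀ u v, u ≠ v → sp u ∨ sp v → e u ≠ e v := fun u v huv hsp heq => by
    rcases lt_or_gt_of_ne (index_ne (θ := θ) huv hsp) with h1 | h1
    · have := heD u v h1
      omega
    · have := heD v u h1
      omega
  have hblock := hB.block_labelling hp hel
  have hspQ : ∀ i, ∀ v ∈ (Q i).erase (ctr i), ¬ sp v := by
    rintro i v hv (⟨j, rfl⟩ | ⟨j, hj⟩)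
    · rcases eq_or_ne i j with rfl | hij
      · simp at hv
      · exact disjoint_left.1 (dQ i j hij) (mem_erase.1 hv).2 (hQ' j).1
    · refine disjoint_left.1 (dQS i j) (mem_erase.1 hv).2 ?_
      rw [(hSig' j).1.2.2.2.2.2.2.1]
      rcases hj with rfl | rfl <;> simp
  have hspS : ∀ j, ∀ v ∈ L₁ j ∪ L₂ j, ¬ sp v := by
    intro j v hv
    obtain ⟨-, -, -, hc₁, hc₂, -, hSeq, -⟩ := (hSig' j).1
    have hvS : v ∈ Sig j := by simp only [hSeq, mem_insert, hv, or_true]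
    rintro (⟨i, rfl⟩ | ⟨i, hi⟩)
    · exact disjoint_left.1 (dQS i j) (hQ' i).1 hvS
    · rcases eq_or_ne i j with rfl | hij
      · rcases hi with rfl | rfl
        · exact hc₁ hv
        · exact hc₂ hv
      · refine disjoint_left.1 (dSig i j hij) ?_ hvS
        rw [(hSig' i).1.2.2.2.2.2.2.1]
        rcases hi with rfl | rfl <;> simp
  have hbet : ∀ j w, sp w → ¬ BetweenSet θ (L₁ j ∪ L₂ j) w := by
    rintro j w (⟨i, rfl⟩ | ⟨i, hi⟩)
    · exact hctr i j
    · rcases eq_or_ne i j with rfl | hij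
      · rcases hi with rfl | rfl
        · exact (hSig' i).2.2.2.2.2.1
        · exact (hSig' i).2.2.2.2.2.2
      · rcases hi with rfl | rfl
        · exact (hcen i j hij).1
        · exact (hcen i j hij).2
  refine contains_of_parts (P := Sum.elim Q Sig) (B := fun v => B (e v) (pos θ v)) ?_ ?_ ?_ ?_
  · rintro (i | i) (j | j) hij
    · exact dQ i j fun h => hij (h ▸ rfl)
    · exact dQS i j
    · exact (dQS j i).symm
    · exact dSig i j fun h => hij (h ▸ rfl)
  · exact fun v => card_pos.1 (Nat.pos_of_mul_pos_left ((hblock v).mul_card_pos hs (by omega)))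
  · intro u v huv hno
    have hlt : pos θ u < pos θ v := by
      refine pos_lt_of_not_backPair (fun hb => hno ?_) huv
      rcases hb with hb | hb
      · rcases hback u v hb with ⟨i, h1, h2⟩ | ⟨i, h1, h2⟩
        · exact ⟨Sum.inl i, h1, h2⟩
        · exact ⟨Sum.inr i, h1, h2⟩
      · exact (H.asymm _ _ huv hb.1).elim
    have hdeg := hB.degree_labelling hp hel hlt
    exact ⟨fun x hx => (Nat.mul_le_mul_right _ hM).trans (hdeg.1 x hx),
      fun y hy => (Nat.mul_le_mul_right _ hM).trans (hdeg.2 y hy)⟩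
  · intro i B' hB'
    have hb' : ∀ v, T.IsBlock s (2 * C) (e v) (B' v) := fun v =>
      (hblock v).mono (hB' v).1 (hB' v).2 (by rw [mul_comm])
    have hlin : ∀ v, sp v → B' v ⊆ s ∧ #s ≤ 2 * C * #(B' v) := fun v hv =>
      ⟨(hb' v).subset, (hb' v).linear (by rw [he2, index_mod_two_of hv])⟩
    have htr : ∀ v, ¬ sp v →
        B' v ⊆ s ∧ T.IsTransOn (B' v) ∧ T.trSizeOn s ≤ 2 * C * #(B' v) := fun v hv =>
      ⟨(hb' v).subset, (hb' v).trans (by rw [he2, index_mod_two_of_not hv])⟩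
    have hne : ∀ v, (B' v).Nonempty := fun v =>
      card_pos.1 (Nat.pos_of_mul_pos_left ((hb' v).mul_card_pos hs (by omega)))
    have hdis : ∀ u v, e u ≠ e v → Disjoint (B' u) (B' v) := fun u v huv =>
      (hB.disjoint_labelling hp hel huv).mono (hB' u).1 (hB' v).1
    have hrel : ∀ u v w, e u ≠ e v → e u ≠ e w → e v ≠ e w → H.BackPair θ u v →
        H.BackPair θ u w → ¬ H.BackPair θ v w → ∀ x ∈ B' u, ∀ y ∈ B' v, ∀ z ∈ B' w,
        T.Realizes H u v x y → T.Realizes H u w x z → T.Realizes H v w y z :=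
      fun u v w h1 h2 h3 h4 h5 h6 x hx y hy z hz => hD.realizes hB hp hel heD'
        (fun v => ⟨(heK v).1, (heK v).2.le⟩) h1 h2 h3 h4 h5 h6 ((hB' u).1 hx) ((hB' v).1 hy)
        ((hB' w).1 hz)
    rcases i with i | j
    · obtain ⟨hcQ, hcb, hnb⟩ := hQ' i
      have hsc : sp (ctr i) := Or.inl ⟨i, rfl⟩
      have hce : ∀ u ∈ (Q i).erase (ctr i), e (ctr i) ≠ e u := fun u hu =>
        hene _ _ (fun h => (mem_erase.1 hu).1 h.symm) (Or.inl hsc)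
      have := hs.exists_star_embedding H (c := ctr i) (L := (Q i).erase (ctr i)) (B := B')
        hC (by simp) (hlin _ hsc).1 (hlin _ hsc).2 (hne _) (fun u hu => htr u (hspQ i u hu))
        (fun u hu => hdis _ _ (hce u hu)) (fun u hu v hv huv x hx y hy z hz hxy hxz => by
          by_cases heq : e u = e v
          · exact hB.adj_of_eq hp hel (pos_lt_of_not_backPair (hnb u hu v hv) huv) heq
              ((hB' u).1 hy) ((hB' v).1 hz)
          · exact (hrel (ctr i) u v (hce u hu) (hce v hv) heq (hcb u hu) (hcb v hv)
              (hnb u hu v hv) x hx y hy z hz hxy hxz).1 huv)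
      rwa [insert_erase hcQ] at this
    · obtain ⟨hcom, hb12, hb1, hb2, hnb, -, -⟩ := hSig' j
      obtain ⟨-, -, -, hc₁, hc₂, hne12, hSeq, -⟩ := hcom
      have hs₁ : sp (c₁ j) := Or.inr ⟨j, Or.inl rfl⟩
      have hs₂ : sp (c₂ j) := Or.inr ⟨j, Or.inr rfl⟩
      have hce : ∀ c, sp c → ∀ u ∈ L₁ j ∪ L₂ j, e c ≠ e u := fun c hc u hu =>
        hene _ _ (fun h => hspS j u hu (h ▸ hc)) (Or.inl hc)
      have he12 : e (c₁ j) ≠ e (c₂ j) := hene _ _ hne12 (Or.inl hs₁)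
      have hsc : ∀ c ∈ ({c₁ j, c₂ j} : Finset (Fin h)), sp c := fun c hc => by
        rcases mem_insert.1 hc with rfl | hc
        · exact hs₁
        · exact mem_singleton.1 hc ▸ hs₂
      have := hs.exists_twoStar_embedding H (B := B') hC hC₀ hne12 hc₁ hc₂
        (fun c hc => hlin c (hsc c hc)) (fun u hu => htr u (hspS j u hu))
        (fun c hc u hu => hdis _ _ (hce c (hsc c hc) u hu)) (hdis _ _ he12)
        (fun u hu v hv huv y hy z hz =>
          hB.adj_of_eq hp hel (pos_lt_of_not_backPair (hnb u hu v hv) huv) (by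
            simp only [e, index_eq_of_not_between (hbet j) (hspS j) hu hv])
            ((hB' u).1 hy) ((hB' v).1 hz))
        (fun u hu x₁ hx₁ x₂ hx₂ y hy h12 h1 => by
          have hu' := mem_union_left (L₂ j) hu
          exact hrel _ _ _ he12 (hce _ hs₁ u hu') (hce _ hs₂ u hu') hb12 (hb1 u hu).1
            (hb1 u hu).2 x₁ hx₁ x₂ hx₂ y hy h12 h1)
        (fun u hu x₁ hx₁ x₂ hx₂ y hy h12 h2 => by
          have hu' := mem_union_right (L₁ j) hu
          exact hrel _ _ _ he12.symm (hce _ hs₂ u hu') (hce _ hs₁ u hu') hb12.symm (hb2 u hu).1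
            (hb2 u hu).2 x₂ hx₂ x₁ hx₁ y hy h12.symm h2)
      rwa [← hSeq] at this

theorem IsFrontierStarAt.isStarAt {T : Tournament n} {θ : Equiv.Perm (Fin n)}
    {S : Finset (Fin n)} {c : Fin n} (hS : T.IsFrontierStarAt θ S c) : T.IsStarAt θ S c :=
  hS.imp_right Or.inl

theorem IsFrontierStarAt.not_between {T : Tournament n} {θ : Equiv.Perm (Fin n)}
    {S : Finset (Fin n)} {c : Fin n} (hS : T.IsFrontierStarAt θ S c) :
    ¬ BetweenSet θ (S.erase c) c := by
  rintro ⟨u, hu, w, hw, huc, hcw⟩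
  rcases hS with hS | hS
  · exact huc.not_gt (hS.2.2.1 u hu).1
  · exact hcw.not_gt (hS.2.2.1 w hw).1

/-- The label of a vertex of index `m` when the vertices of indices `α < β < γ` are to receive
the labels `i`, `j` and `k`. -/
def stretch (α β γ i j k m : ℕ) : ℕ :=
  if m < α then m else if m = α then i else if m < β then i + 2 - i % 2 + m else
  if m = β then j else if m < γ then j + 2 - j % 2 + m else if m = γ then k else
  k + 2 - k % 2 + m

section Stretch

variable {α β γ i j k D K l m m' : ℕ}

theorem stretch_left : stretch α β γ i j k α = i := by simp [stretch]

theorem stretch_center (h₁ : α < β) : stretch α β γ i j k β = j := by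
  simp [stretch, h₁.ne', h₁.not_gt]

theorem stretch_right (h₁ : α < β) (h₂ : β < γ) : stretch α β γ i j k γ = k := by
  simp [stretch, h₂.ne', h₂.not_gt, (h₁.trans h₂).ne', (h₁.trans h₂).not_gt]

theorem stretch_mod_two (hα : m ≠ α) (hβ : m ≠ β) (hγ : m ≠ γ) :
    stretch α β γ i j k m % 2 = m % 2 := by
  unfold stretch
  split_ifs <;> omega

theorem stretch_lt_stretch (h₁ : α < β) (h₂ : β < γ) (hi : D ≤ i) (hij : i + D ≤ j)
    (hjk : j + D ≤ k) (hl : l + 2 < D) (hm : m < m') (hm' : m' ≤ l) :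
    stretch α β γ i j k m < stretch α β γ i j k m' := by
  unfold stretch
  split_ifs <;> omega

theorem stretch_lt (hi : D ≤ i) (hij : i + D ≤ j) (hjk : j + D ≤ k) (hk : k + D ≤ K)
    (hl : l + 2 < D) (hm : m ≤ l) : stretch α β γ i j k m < K := by
  unfold stretch
  split_ifs <;> omega

end Stretch

/-- In a rich set of a tournament not containing a given Δgalaxy, block families have no
well-separated backward triangles. -/
theorem IsBlockFamily.noBackTriangle {T : Tournament N} {s : Finset (Fin N)}
    {K p M C C₀ D : ℕ} {B : ℕ → ℕ → Finset (Fin N)} (hs : T.IsRich s C₀)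
    (hB : T.IsBlockFamily s K p M C B) (G : Tournament h) (hG : G.IsDeltaGalaxy)
    (hT : ¬ T.Contains G) (hp : h ≤ p) (hM : 4 * h ≤ M) (hM6 : 6 ≤ M)
    (hC : 2 * h * (4 * C) ≤ C₀) (hC₀ : 0 < C₀) (hD : 2 * h + 3 < D) :
    T.NoBackTriangle K p D B := by
  intro i j k hi hij hjk hk ja hja jb hjb jc hjc x hx y hy z hz hyx hzx hzy
  refine hT ?_
  obtain ⟨θ, a, b, c, l, Q, ctr, htri, hfr, -, dtQ, dQ, hback, hctr, hforb⟩ := hG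
  obtain ⟨hab, hbc, gba, gca, gcb⟩ := htri 0
  have hQ := fun i => (hfr i).isStarAt.spec
  set tri : Finset (Fin h) := {a, b, c} with htri_def
  have hab' : a ≠ b := fun h => hab.ne (h ▸ rfl)
  have hbc' : b ≠ c := fun h => hbc.ne (h ▸ rfl)
  have hac' : a ≠ c := fun h => (hab.trans hbc).ne (h ▸ rfl)
  have htQ : ∀ i, ∀ t ∈ tri, t ∉ Q i := fun i t ht => disjoint_left.1 (dtQ 0 i) ht
  let sp (v : Fin h) : Prop := v ∈ tri ∨ ∃ i, v = ctr i
  have hsa : sp a := Or.inl (by simp [tri])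
  have hsb : sp b := Or.inl (by simp [tri])
  have hsc : sp c := Or.inl (by simp [tri])
  let e (v : Fin h) : ℕ :=
    stretch (index θ sp a) (index θ sp b) (index θ sp c) i j k (index θ sp v)
  have h₁ : index θ sp a < index θ sp b := (index_mono hab).resolve_right fun h => h.2.1 hsa
  have h₂ : index θ sp b < index θ sp c := (index_mono hbc).resolve_right fun h => h.2.1 hsb
  have hea : e a = i := stretch_left
  have heb : e b = j := stretch_center h₁
  have hec : e c = k := stretch_right h₁ h₂
  have helt : ∀ u v, index θ sp u < index θ sp v → e u < e v := fun u v huv =>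
    stretch_lt_stretch h₁ h₂ hi hij hjk hD huv (index_le θ sp v)
  have heK : ∀ v, e v < K := fun v => stretch_lt hi hij hjk hk hD (index_le θ sp v)
  have hene : ∀ u v, u ≠ v → sp u ∨ sp v → e u ≠ e v := fun u v huv hsp => by
    rcases lt_or_gt_of_ne (index_ne (θ := θ) huv hsp) with h | h
    · exact (helt u v h).ne
    · exact (helt v u h).ne'
  have he2 : ∀ v, v ∉ tri → e v % 2 = index θ sp v % 2 := fun v hv => by
    simp only [tri, mem_insert, mem_singleton, not_or] at hv
    exact stretch_mod_two (index_ne hv.1 (Or.inr hsa)) (index_ne hv.2.1 (Or.inr hsb))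
      (index_ne hv.2.2 (Or.inr hsc))
  let q (v : Fin h) : ℕ :=
    if v = a then ja else if v = b then jb else if v = c then jc else pos θ v
  have hq : ∀ v, v ∉ tri → q v = pos θ v := fun v hv => by
    simp only [tri, mem_insert, mem_singleton, not_or] at hv
    simp [q, hv]
  have hqp : ∀ v, q v < p := fun v => by
    have := (pos θ v).2
    simp only [q]
    split_ifs <;> omega
  let fx (v : Fin h) : Fin N := if v = a then x else if v = b then y else z
  have hfx : ∀ t ∈ tri, fx t ∈ B (e t) (q t) := by
    intro t ht
    simp only [tri, mem_insert, mem_singleton] at ht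
    rcases ht with rfl | rfl | rfl
    · simpa [fx, q, hea] using hx
    · simpa [fx, q, heb, hab'.symm] using hy
    · simpa [fx, q, hec, hac'.symm, hbc'.symm] using hz
  have hmono : ∀ u v, pos θ u < pos θ v →
      e u < e v ∨ e u = e v ∧ e u % 2 = 0 ∧ q u < q v := fun u v huv => by
    rcases index_mono (sp := sp) huv with h | ⟨h, hu, hv⟩
    · exact Or.inl (helt u v h)
    · have hu' : u ∉ tri := fun h => hu (Or.inl h)
      have hv' : v ∉ tri := fun h => hv (Or.inl h)
      exact Or.inr ⟨by simp only [e, h], by rw [he2 u hu', index_mod_two_of_not hu],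
        by rw [hq u hu', hq v hv']; exact huv⟩
  have hdeg := fun u v huv => hB.degree (hmono u v huv) (heK v) (hqp u) (hqp v)
  have hblock := fun v => hB.block (e v) (heK v) (q v) (hqp v)
  have hnb : ∀ t ∈ tri, ∀ v, v ∉ tri → ¬ G.Backward θ t v ∧ ¬ G.Backward θ v t := by
    refine fun t ht v hv => ⟨fun hb => ?_, fun hb => ?_⟩
    · rcases hback t v hb with ⟨_, h⟩ | ⟨i, h, -⟩
      · exact hv h.2
      · exact htQ i t ht h
    · rcases hback v t hb with ⟨_, h⟩ | ⟨i, -, h⟩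
      · exact hv h.1
      · exact htQ i t ht h
  have hfilter : ∀ v, ∃ F ⊆ B (e v) (q v), #(B (e v) (q v)) ≤ 2 * #F ∧
      ∀ w ∈ F, ∀ t ∈ tri, v ∉ tri → T.Realizes G t v (fx t) w := by
    intro v
    refine exists_half_forall (K := 3) card_le_three fun t ht E hE hbad => ?_
    have hM' : 2 * 3 * #E ≤ M * #E := Nat.mul_le_mul_right _ hM6
    rcases E.eq_empty_or_nonempty with rfl | ⟨w₀, hw₀⟩
    · simp
    have hv : v ∉ tri := fun hv => hbad w₀ hw₀ fun h => (h hv).elim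
    have hbad' : ∀ w ∈ E, ¬ T.Realizes G t v (fx t) w := fun w hw hr => hbad w hw fun _ => hr
    have hnb' := hnb t ht v hv
    rcases lt_or_gt_of_ne ((pos_injective θ).ne fun h : t = v => hv (h ▸ ht)) with hlt | hlt
    · refine hM'.trans (le_trans (Nat.mul_le_mul_left _ (card_le_card fun w hw => ?_))
        ((hdeg t v hlt).1 _ (hfx t ht)))
      refine mem_filter.2 ⟨hE hw, fun hadj => hbad' w hw ⟨fun _ => hadj, fun h => ?_⟩⟩
      exact (hnb'.2 ⟨h, hlt⟩).elim
    · refine hM'.trans (le_trans (Nat.mul_le_mul_left _ (card_le_card fun w hw => ?_))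
        ((hdeg v t hlt).2 _ (hfx t ht)))
      refine mem_filter.2 ⟨hE hw, fun hadj => hbad' w hw ⟨fun h => ?_, fun _ => hadj⟩⟩
      exact (hnb'.1 ⟨h, hlt⟩).elim
  choose F hFB hFc hF using hfilter
  have hFne : ∀ v, (F v).Nonempty := fun v => by
    have := Nat.pos_of_mul_pos_left ((hblock v).mul_card_pos hs hC₀)
    have := hFc v
    exact card_pos.1 (by omega)
  let Z (v : Fin h) : Finset (Fin N) := if v ∈ tri then {fx v} else F v
  have hZt : ∀ v ∈ tri, Z v = {fx v} := fun v hv => if_pos hv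
  have hZF : ∀ v, v ∉ tri → Z v = F v := fun v hv => if_neg hv
  have hspQ : ∀ i, ∀ v ∈ (Q i).erase (ctr i), ¬ sp v := by
    rintro i v hv (ht | ⟨j, rfl⟩)
    · exact htQ i v ht (mem_erase.1 hv).2
    · rcases eq_or_ne i j with rfl | hij
      · simp at hv
      · exact disjoint_left.1 (dQ i j hij) (mem_erase.1 hv).2 (hQ j).1
  have hbet : ∀ j w, sp w → ¬ BetweenSet θ ((Q j).erase (ctr j)) w := by
    rintro j w (ht | ⟨i, rfl⟩)
    · exact hforb 0 j w ht
    · rcases eq_or_ne i j with rfl | hij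
      · exact (hfr i).not_between
      · exact hctr i j hij
  refine contains_of_parts (P := fun o : Option (Fin l) => o.elim tri Q) (B := Z) ?_ ?_ ?_ ?_
  · rintro (_ | i) (_ | j) hij
    · exact (hij rfl).elim
    · exact dtQ 0 j
    · exact (dtQ 0 i).symm
    · exact dQ i j fun h => hij (h ▸ rfl)
  · intro v
    by_cases hv : v ∈ tri
    · simp [hZt v hv]
    · exact hZF v hv ▸ hFne v
  · intro u v huv hno
    have hlt : pos θ u < pos θ v := by
      refine pos_lt_of_not_backPair (fun hb => hno ?_) huv
      rcases hb with hb | hb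
      · rcases hback u v hb with ⟨_, h⟩ | ⟨i, h⟩
        · exact ⟨none, h⟩
        · exact ⟨some i, h⟩
      · exact (G.asymm _ _ huv hb.1).elim
    have hall : (∀ x ∈ Z u, ∀ y ∈ Z v, T.adj x y) →
        (∀ x ∈ Z u, 2 * h * #{y ∈ Z v | ¬ T.adj x y} ≤ #(Z v)) ∧
        ∀ y ∈ Z v, 2 * h * #{x ∈ Z u | ¬ T.adj x y} ≤ #(Z u) := fun h => by
      refine ⟨fun x hx => ?_, fun y hy => ?_⟩
      · rw [filter_eq_empty_iff.2 fun y hy => not_not.2 (h x hx y hy)]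
        simp
      · rw [filter_eq_empty_iff.2 fun x hx => not_not.2 (h x hx y hy)]
        simp
    by_cases hu : u ∈ tri <;> by_cases hv : v ∈ tri
    · exact (hno ⟨none, hu, hv⟩).elim
    · refine hall fun x hx y hy => ?_
      rw [hZt u hu, mem_singleton] at hx
      rw [hZF v hv] at hy
      exact hx ▸ (hF v y hy u hu hv).1 huv
    · refine hall fun x hx y hy => ?_
      rw [hZt v hv, mem_singleton] at hy
      rw [hZF u hu] at hx
      exact hy ▸ (hF u x hx v hv hu).2 huv
    · rw [hZF u hu, hZF v hv]
      have key : ∀ w (r : Fin N → Prop) [DecidablePred r],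
          M * #{y ∈ B (e w) (q w) | r y} ≤ #(B (e w) (q w)) →
          2 * h * #{y ∈ F w | r y} ≤ #(F w) := fun w r _ hr => by
        have h3 : 4 * h * #{y ∈ F w | r y} ≤ M * #{y ∈ B (e w) (q w) | r y} :=
          Nat.mul_le_mul hM (card_le_card (filter_subset_filter _ (hFB w)))
        have h4 := hFc w
        have h5 : 4 * h * #{y ∈ F w | r y} = 2 * (2 * h * #{y ∈ F w | r y}) := by ring
        omega
      exact ⟨fun x hx => key v _ ((hdeg u v hlt).1 x (hFB u hx)),
        fun y hy => key u _ ((hdeg u v hlt).2 y (hFB v hy))⟩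
  · rintro (_ | i) B' hB'
    · refine ⟨fx, fun v hv => ?_, ?_⟩
      · have h3 := hB' v
        rw [hZt v hv, card_singleton] at h3
        obtain ⟨w, hw⟩ : (B' v).Nonempty := card_pos.1 (by omega)
        exact mem_singleton.1 (h3.1 hw) ▸ hw
      · have fa : fx a = x := by simp [fx]
        have fb : fx b = y := by simp [fx, hab'.symm]
        have fc : fx c = z := by simp [fx, hac'.symm, hbc'.symm]
        intro u hu v hv huv
        simp only [Option.elim, tri, mem_insert, mem_singleton] at hu hv
        rcases hu with rfl | rfl | rfl <;> rcases hv with rfl | rfl | rfl <;>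
          simp only [fa, fb, fc] <;>
          first
          | assumption
          | exact (G.adj_irrefl _ huv).elim
          | exact (G.asymm _ _ huv (by assumption)).elim
    · obtain ⟨hcQ, hcb, hnbQ⟩ := hQ i
      have hnt : ∀ v ∈ Q i, v ∉ tri := fun v hv ht => htQ i v ht hv
      have hL : ∀ v ∈ (Q i).erase (ctr i), v ∈ Q i := fun v hv => (mem_erase.1 hv).2
      have hsub : ∀ v ∈ Q i, B' v ⊆ B (e v) (q v) := fun v hv =>
        (hB' v).1.trans (hZF v (hnt v hv) ▸ hFB v)
      have hcard : ∀ v ∈ Q i, #(B (e v) (q v)) ≤ 4 * #(B' v) := fun v hv => by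
        have h3 := (hB' v).2
        rw [hZF v (hnt v hv)] at h3
        have h4 := hFc v
        omega
      have hb' : ∀ v ∈ Q i, T.IsBlock s (4 * C) (e v) (B' v) := fun v hv =>
        (hblock v).mono (hsub v hv) (hcard v hv) (by rw [mul_comm])
      have hs_c : sp (ctr i) := Or.inr ⟨i, rfl⟩
      have hodd : e (ctr i) % 2 = 1 := by rw [he2 _ (hnt _ hcQ), index_mod_two_of hs_c]
      have heven : ∀ u ∈ (Q i).erase (ctr i), e u % 2 = 0 := fun u hu => by
        rw [he2 _ (hnt _ (hL u hu)), index_mod_two_of_not (hspQ i u hu)]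
      have := hs.exists_star_embedding G (c := ctr i) (L := (Q i).erase (ctr i)) (B := B')
        hC (by simp) (hb' _ hcQ).subset ((hb' _ hcQ).linear hodd)
        (card_pos.1 (Nat.pos_of_mul_pos_left ((hb' _ hcQ).mul_card_pos hs hC₀)))
        (fun u hu => ⟨(hb' u (hL u hu)).subset, (hb' u (hL u hu)).trans (heven u hu)⟩)
        (fun u hu => (hB.disjoint _ (heK _) _ (heK u)
          (hene _ _ (fun h => (mem_erase.1 hu).1 h.symm) (Or.inl hs_c)) _ (hqp _) _ (hqp u)).mono
          (hsub _ hcQ) (hsub u (hL u hu)))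
        (fun u hu v hv huv x hx y hy z hz hxy hxz => by
          have heq : e u = e v := by
            simp only [e, index_eq_of_not_between (hbet i) (hspQ i) hu hv]
          refine hB.chunk _ (heK u) (heven u hu) (q u) (q v) ?_ (hqp v) y
            (hsub u (hL u hu) hy) z (heq ▸ hsub v (hL v hv) hz)
          rw [hq u (hnt u (hL u hu)), hq v (hnt v (hL v hv))]
          exact pos_lt_of_not_backPair (hnbQ u hu v hv) huv)
      rwa [insert_erase hcQ] at this

theorem IsTransOn.union {T : Tournament N} {X Y : Finset (Fin N)} (hX : T.IsTransOn X)
    (hY : T.IsTransOn Y) (h : ∀ x ∈ X, ∀ y ∈ Y, T.adj x y) : T.IsTransOn (X ∪ Y) := by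
  have has := T.asymm
  intro u hu v hv w hw huv hvw
  rw [mem_union] at hu hv hw
  rcases hu with hu | hu <;> rcases hv with hv | hv <;> rcases hw with hw | hw
  · exact hX u hu v hv w hw huv hvw
  · exact h u hu w hw
  · exact (has _ _ hvw (h w hw v hv)).elim
  · exact h u hu w hw
  · exact (has _ _ huv (h v hv u hu)).elim
  · exact (has _ _ huv (h v hv u hu)).elim
  · exact (has _ _ hvw (h w hw v hv)).elim
  · exact hY u hu v hv w hw huv hvw

theorem isTransOn_singleton (T : Tournament N) (v : Fin N) : T.IsTransOn {v} := by
  intro u hu w hw x hx huw _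
  rw [mem_singleton] at hu hw
  exact (T.adj_irrefl v (by rwa [hu, hw] at huw)).elim

/-- Every set of `2 ^ k` vertices contains a transitive set of `k + 1` vertices. -/
theorem lt_trSizeOn_of_two_pow_le (T : Tournament N) :
    ∀ (k : ℕ) (s : Finset (Fin N)), 2 ^ k ≤ #s → k < T.trSizeOn s
  | 0, s, hs => by
    obtain ⟨v, hv⟩ := card_pos.1 hs
    exact (T.isTransOn_singleton v).card_le (singleton_subset_iff.2 hv)
  | k + 1, s, hs => by
    obtain ⟨v, hv⟩ := card_pos.1 ((Nat.two_pow_pos _).trans_le hs)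
    have hc := card_filter_add_card_filter_not (s := s.erase v) fun w => T.adj v w
    rw [card_erase_of_mem hv] at hc
    have hext : ∀ A ⊆ s, v ∉ A → 2 ^ k ≤ #A → ((∀ w ∈ A, T.adj v w) ∨ ∀ w ∈ A, T.adj w v) →
        k + 1 < T.trSizeOn s := fun A hA hvA hAk hdir => by
      obtain ⟨t, htA, ht, htc⟩ := exists_card_eq_trSizeOn T A
      have hlt := lt_trSizeOn_of_two_pow_le T k A hAk
      have hvt : v ∉ t := fun h => hvA (htA h)
      have htr : T.IsTransOn (insert v t) := by
        rcases hdir with hdir | hdir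
        · exact (T.isTransOn_singleton v).union ht fun x hx y hy =>
            mem_singleton.1 hx ▸ hdir y (htA hy)
        · rw [insert_eq, union_comm]
          exact ht.union (T.isTransOn_singleton v) fun x hx y hy =>
            mem_singleton.1 hy ▸ hdir x (htA hx)
      have := htr.card_le (insert_subset hv (htA.trans hA))
      rw [card_insert_of_notMem hvt] at this
      omega
    have hsub : ∀ A ⊆ s.erase v, A ⊆ s ∧ v ∉ A := fun A hA =>
      ⟨hA.trans (erase_subset _ _), fun h => notMem_erase v s (hA h)⟩
    rcases le_or_gt (2 ^ k) #{w ∈ s.erase v | T.adj v w} with h1 | h1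
    · obtain ⟨h2, h3⟩ := hsub _ (filter_subset (fun w => T.adj v w) (s.erase v))
      exact hext _ h2 h3 h1 (Or.inl fun w hw => (mem_filter.1 hw).2)
    · rw [pow_succ] at hs
      have h4 : 2 ^ k ≤ #{w ∈ s.erase v | ¬ T.adj v w} := by omega
      obtain ⟨h2, h3⟩ := hsub _ (filter_subset (fun w => ¬ T.adj v w) (s.erase v))
      exact hext _ h2 h3 h4 (Or.inr fun w hw => T.adj_of_not_adj
        (ne_of_mem_erase (mem_filter.1 hw).1).symm (mem_filter.1 hw).2)

/-- If the largest transitive set of `T` is smaller than `n ^ ε` for small `ε`, then `T` has a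
rich set. -/
theorem exists_isRich (C : ℕ) (hC : 2 ≤ C) : ∃ ε : ℝ, 0 < ε ∧ ∀ {n : ℕ} (T : Tournament n),
    (T.trSize : ℝ) < (n : ℝ) ^ ε → ∃ s, T.IsRich s C := by
  have hC2 : (2 : ℝ) ≤ C := by exact_mod_cast hC
  have hC0 : (0 : ℝ) < C := by linarith
  set ε : ℝ := ((C : ℝ) ^ 2)⁻¹ with hε
  have hε0 : 0 < ε := by positivity
  have hε1 : ε ≤ 1 := inv_le_one_of_one_le₀ (one_le_pow₀ (by linarith))
  have hpow : (C : ℝ) ^ ε * (C - 1) ≤ C := by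
    have h1 := rpow_one_add_le_one_add_mul_self (s := C - 1) (by linarith) hε0.le hε1
    rw [add_sub_cancel] at h1
    have h2 : ε * (C : ℝ) ^ 2 = 1 := inv_mul_cancel₀ (by positivity)
    calc (C : ℝ) ^ ε * (C - 1) ≤ (1 + ε * (C - 1)) * (C - 1) :=
          mul_le_mul_of_nonneg_right h1 (by linarith)
      _ = C - 1 + ε * (C - 1) ^ 2 := by ring
      _ ≤ C - 1 + ε * (C : ℝ) ^ 2 := by
        gcongr
        · linarith
        · linarith
      _ = C := by rw [h2]; ring
  refine ⟨ε, hε0, fun {n} T hT => ?_⟩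
  obtain ⟨s, hs, hmin⟩ := exists_min_image
    (univ.filter fun s : Finset (Fin n) => (T.trSizeOn s : ℝ) < (#s : ℝ) ^ ε) card
    ⟨univ, by simpa [trSize] using hT⟩
  simp only [mem_filter, mem_univ, true_and] at hs hmin
  set t := T.trSizeOn s with ht
  have hsmall : ∀ X ⊆ s, X ≠ s → #s ≤ C * #X → C * t < C * T.trSizeOn X + t := by
    intro X hX hne hXc
    have h1 : (#X : ℝ) ^ ε ≤ T.trSizeOn X := by
      by_contra! h
      exact (hmin X h).not_gt (card_lt_card (hX.ssubset_of_ne hne))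
    have h2 : (t : ℝ) < (C : ℝ) ^ ε * T.trSizeOn X := calc
      (t : ℝ) < (#s : ℝ) ^ ε := hs
      _ ≤ ((C : ℝ) * #X) ^ ε :=
        Real.rpow_le_rpow (by positivity) (by exact_mod_cast hXc) hε0.le
      _ = (C : ℝ) ^ ε * (#X : ℝ) ^ ε := Real.mul_rpow hC0.le (by positivity)
      _ ≤ _ := by gcongr
    have h3 : (C - 1 : ℝ) * t < C * T.trSizeOn X := calc
      (C - 1 : ℝ) * t < (C - 1) * ((C : ℝ) ^ ε * T.trSizeOn X) :=
        mul_lt_mul_of_pos_left h2 (by linarith)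
      _ = (C : ℝ) ^ ε * (C - 1) * T.trSizeOn X := by ring
      _ ≤ _ := by gcongr
    have h4 : (C : ℝ) * t < C * T.trSizeOn X + t := by linarith
    exact_mod_cast h4
  have hcard : 2 ^ C ≤ #s := by
    have h1 : 1 ≤ #s := by
      by_contra! h
      obtain rfl : s = ∅ := by simpa using h
      rw [card_empty, Nat.cast_zero, Real.zero_rpow hε0.ne'] at hs
      exact hs.not_ge (Nat.cast_nonneg _)
    have h2 : 2 ^ 1 ≤ #s := by
      by_contra! h
      have h3 : 0 < t := lt_trSizeOn_of_two_pow_le T 0 s h1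
      rw [show #s = 1 by omega, Nat.cast_one, Real.one_rpow] at hs
      exact hs.not_ge (by exact_mod_cast h3)
    have h3 : 2 ≤ t := lt_trSizeOn_of_two_pow_le T 1 s h2
    by_contra! h
    have h4 : (#s : ℝ) ≤ 2 ^ (C ^ 2 : ℕ) := by
      exact_mod_cast h.le.trans (Nat.pow_le_pow_right two_pos (Nat.le_self_pow two_ne_zero C))
    have h5 : (#s : ℝ) ^ ε ≤ 2 := calc
      (#s : ℝ) ^ ε ≤ ((2 : ℝ) ^ (C ^ 2 : ℕ)) ^ ε :=
        Real.rpow_le_rpow (by positivity) h4 hε0.le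
      _ = 2 := by
        rw [← Real.rpow_natCast, ← Real.rpow_mul (by norm_num), hε, Nat.cast_pow,
          mul_inv_cancel₀ (by positivity), Real.rpow_one]
    have h6 : (2 : ℝ) ≤ t := by exact_mod_cast h3
    linarith
  have htC : C < t := lt_trSizeOn_of_two_pow_le T C s hcard
  have hcomp : ∀ X ⊆ s, ∀ Y ⊆ s, #s ≤ C * #X → T.IsTransOn Y → t ≤ C * #Y →
      ¬ ((∀ x ∈ X, ∀ y ∈ Y, T.adj x y) ∨ ∀ x ∈ X, ∀ y ∈ Y, T.adj y x) := by
    intro X hX Y hY hXc hYt hYc hdir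
    obtain ⟨Z, hZX, hZ, hZc⟩ := exists_card_eq_trSizeOn T X
    have hdis : Disjoint X Y := disjoint_left.2 fun x hx hy =>
      T.adj_irrefl x (hdir.elim (fun h => h x hx x hy) fun h => h x hx x hy)
    obtain ⟨y, hy⟩ : Y.Nonempty :=
      card_pos.1 (Nat.pos_of_mul_pos_left ((Nat.zero_lt_of_lt htC).trans_le hYc))
    have hXs : X ≠ s := fun h => disjoint_left.1 hdis (h ▸ hY hy) hy
    have htr : T.IsTransOn (Z ∪ Y) := by
      rcases hdir with h | h
      · exact hZ.union hYt fun x hx => h x (hZX hx)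
      · rw [union_comm]
        exact hYt.union hZ fun y hy x hx => h x (hZX hx) y hy
    have h1 := htr.card_le (union_subset (hZX.trans hX) hY)
    rw [card_union_of_disjoint (hdis.mono_left hZX), hZc] at h1
    have h2 := hsmall X hX hXs hXc
    have h3 := Nat.mul_le_mul_left C h1
    rw [← ht, Nat.mul_add] at h3
    omega
  refine ⟨s, Nat.lt_two_pow_self.le.trans hcard, htC.le, fun X hX hXc => ?_,
    fun X hX Y hY hXc hYt hYc => ?_⟩
  · obtain ⟨R, hRX, hR, hRc⟩ := exists_card_eq_trSizeOn T X
    refine ⟨R, hRX, hR, ?_⟩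
    rw [hRc]
    rcases eq_or_ne X s with rfl | hne
    · omega
    · have h1 := hsmall X hX hne hXc
      have h2 : 2 * t ≤ C * t := Nat.mul_le_mul_right _ hC
      refine Nat.le_of_mul_le_mul_left ?_ (by omega : 0 < C)
      calc C * t ≤ 2 * (C * T.trSizeOn X) := by omega
        _ = _ := by ring
  · have h1 := hcomp X hX Y hY hXc hYt hYc
    push Not at h1
    exact h1

theorem IsSuperNebula.contains_or_contains {n₁ n₂ : ℕ} {H : Tournament n₁} {G : Tournament n₂}
    (hH : H.IsSuperNebula) (hG : G.IsDeltaGalaxy) : ∃ C : ℕ, 2 ≤ C ∧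
      ∀ {N : ℕ} (T : Tournament N) (s : Finset (Fin N)), T.IsRich s C →
        T.Contains H ∨ T.Contains G := by
  let D := 2 * n₂ + 4
  obtain ⟨C, hC⟩ := exists_isBlockFamily G ((D + 1) * (2 * n₁ + 1) + 2 * D + 1) (n₁ + n₂)
    (2 * n₁ + 4 * n₂ + 6)
  have h1 : 2 * n₁ * (2 * C) = 4 * n₁ * C := by ring
  have h2 : 2 * n₂ * (4 * C) = 8 * n₂ * C := by ring
  refine ⟨C + 4 * n₁ * C + 8 * n₂ * C + 2, by omega, fun {N} T s hs => ?_⟩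
  refine or_iff_not_imp_right.2 fun hT => ?_
  obtain ⟨B, hB⟩ := hC T s (hs.mono (by omega)) hT
  have hD : T.NoBackTriangle _ _ D B := hB.noBackTriangle hs G hG hT (by omega) (by omega)
    (by omega) (by omega) (by omega) (by omega)
  exact hB.contains_superNebula hs hD (by omega) H hH (by omega) (by omega) le_rfl (by omega)
    (by omega)

end Tournament

end

theorem superNebula_deltaGalaxy_EH {n₁ n₂ : ℕ} (Nb : Tournament n₁) (G : Tournament n₂)
    (hN : Nb.IsSuperNebula) (hG : G.IsDeltaGalaxy) : EHPair Nb G := by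
  obtain ⟨C, hC, hcontains⟩ := hN.contains_or_contains hG
  obtain ⟨ε, hε, hrich⟩ := exists_isRich C hC
  refine ⟨ε, hε, fun n T hTN hTG => ?_⟩
  by_contra! hT
  obtain ⟨s, hs⟩ := hrich T hT
  exact (hcontains T s hs).elim hTN hTG
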